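/- There exists a universal constant C_K > 0 such that for every α ∈ ℝ, every N ≥ 2, and every normalized N-anyon wave function u with one-particle density ρ: ∑_{j=1}^N ∫_{(ℝ²)^N} |D_j u|² dx ≥ C_K · C_{α,N}² · ∫_{ℝ²} ρ(x)² dx. -/

import Mathlib

open MeasureTheory

noncomputable section

/-- Squared magnitude of the covariant derivative `D_j u` at configuration `x`;
the plane `ℝ²` is identified with `ℂ` (so `a^⊥ = I·a`, and the two components of a
vector field are the real and imaginary parts). -/
def covSq (α : ℝ) {N : ℕ} (u : (Fin N → ℂ) → ℂ) (j : Fin N) (x : Fin N → ℂ) : ℝ :=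
  let A : ℂ := (α : ℂ) * ∑ k ∈ Finset.univ.erase j,
    Complex.I * (x j - x k) / ((‖x j - x k‖ : ℂ) ^ 2)
  ‖-Complex.I * fderiv ℝ u x (Pi.single j 1) + (A.re : ℂ) * u x‖ ^ 2 +
    ‖-Complex.I * fderiv ℝ u x (Pi.single j Complex.I) + (A.im : ℂ) * u x‖ ^ 2

/-- The statistics constant `C_{α,N} = min_{p ∈ {0,…,N-2}} min_{q ∈ ℤ} |(2p+1)α - 2q|`. -/
def statC (α : ℝ) (N : ℕ) : ℝ :=
  ⨅ p : Fin (N - 1), ⨅ q : ℤ, |(2 * ((p : ℕ) : ℝ) + 1) * α - 2 * (q : ℝ)|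

/-- `N`-anyon wave function in the magnetic gauge (smooth compactly supported
form-core representative): totally symmetric with support away from the diagonals. -/
structure IsAnyonWF (N : ℕ) (u : (Fin N → ℂ) → ℂ) : Prop where
  smooth : ContDiff ℝ (⊤ : ℕ∞) u
  compactSupport : HasCompactSupport u
  symmetric : ∀ (σ : Equiv.Perm (Fin N)) (x : Fin N → ℂ), u (x ∘ σ) = u x
  offDiagonal : ∀ x ∈ tsupport u, ∀ j k : Fin N, j ≠ k → x j ≠ x k

/-- One-particle density of an `N`-particle wave function. -/
def density (N : ℕ) (u : (Fin N → ℂ) → ℂ) (y : ℂ) : ℝ :=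
  ∑ j : Fin N, ∫ z : {k : Fin N // k ≠ j} → ℂ,
    ‖u (fun k => if h : k = j then y else z ⟨k, h⟩)‖ ^ 2

section AnyonKineticEnergy

open scoped ENNReal ComplexConjugate

/-- The magnetic potential felt by particle `j`, as a complex number. -/
def potential (α : ℝ) {N : ℕ} (j : Fin N) (x : Fin N → ℂ) : ℂ :=
  (α : ℂ) * ∑ k ∈ Finset.univ.erase j,
    Complex.I * (x j - x k) / ((‖x j - x k‖ : ℂ) ^ 2)

/-- The magnitude of the covariant derivative `D_j u`. -/
def covNorm (α : ℝ) {N : ℕ} (u : (Fin N → ℂ) → ℂ) (j : Fin N) (x : Fin N → ℂ) : ℝ≥0∞ :=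
  ENNReal.ofReal (Real.sqrt (covSq α u j x))

/-- The configuration in which particle `j` sits at `y` and the others at `z`. -/
def insertAt {N : ℕ} (j : Fin N) (y : ℂ) (z : {k : Fin N // k ≠ j} → ℂ) : Fin N → ℂ :=
  fun k => if h : k = j then y else z ⟨k, h⟩

section Pointwise

variable {N : ℕ} {α : ℝ} {u : (Fin N → ℂ) → ℂ}

theorem covSq_nonneg (j : Fin N) (x : Fin N → ℂ) : 0 ≤ covSq α u j x := by
  unfold covSq; positivity

theorem covNorm_sq (j : Fin N) (x : Fin N → ℂ) :
    covNorm α u j x ^ 2 = ENNReal.ofReal (covSq α u j x) := by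
  unfold covNorm
  rw [← ENNReal.ofReal_pow (Real.sqrt_nonneg _), Real.sq_sqrt (covSq_nonneg j x)]

theorem fderiv_apply_single (j : Fin N) (x : Fin N → ℂ) (v : ℂ) :
    fderiv ℝ u x (Pi.single j v) = (v.re : ℂ) * fderiv ℝ u x (Pi.single j 1)
      + (v.im : ℂ) * fderiv ℝ u x (Pi.single j Complex.I) := by
  have h : (Pi.single j v : Fin N → ℂ) =
      v.re • (Pi.single j 1 : Fin N → ℂ) + v.im • (Pi.single j Complex.I : Fin N → ℂ) := by
    rw [← Pi.single_smul, ← Pi.single_smul, ← Pi.single_add]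
    congr 1
    simp
  rw [h, map_add, map_smul, map_smul]
  simp

theorem norm_real_combination_le (a b : ℝ) (z w : ℂ) :
    ‖(a : ℂ) * z + (b : ℂ) * w‖ ≤ Real.sqrt (a ^ 2 + b ^ 2) * Real.sqrt (‖z‖ ^ 2 + ‖w‖ ^ 2) := by
  rw [← Real.sqrt_mul (by positivity)]
  apply Real.le_sqrt_of_sq_le
  have h : ‖(a : ℂ) * z + (b : ℂ) * w‖ ≤ |a| * ‖z‖ + |b| * ‖w‖ := by
    refine (norm_add_le _ _).trans ?_
    simp
  have h2 : ‖(a : ℂ) * z + (b : ℂ) * w‖ ^ 2 ≤ (|a| * ‖z‖ + |b| * ‖w‖) ^ 2 := by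
    gcongr
  refine h2.trans ?_
  rw [← sq_abs a, ← sq_abs b]
  nlinarith [sq_nonneg (|a| * ‖w‖ - |b| * ‖z‖)]

theorem norm_covariant_le (j : Fin N) (x : Fin N → ℂ) (v : ℂ) :
    ‖fderiv ℝ u x (Pi.single j v)
      + Complex.I * ((conj (potential α j x) * v).re : ℂ) * u x‖
      ≤ ‖v‖ * Real.sqrt (covSq α u j x) := by
  have key : fderiv ℝ u x (Pi.single j v)
      + Complex.I * ((conj (potential α j x) * v).re : ℂ) * u x = Complex.I *
      ((v.re : ℂ) * (-Complex.I * fderiv ℝ u x (Pi.single j 1)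
          + ((potential α j x).re : ℂ) * u x)
        + (v.im : ℂ) * (-Complex.I * fderiv ℝ u x (Pi.single j Complex.I)
          + ((potential α j x).im : ℂ) * u x)) := by
    rw [fderiv_apply_single]
    have hI := Complex.I_mul_I
    have : ((conj (potential α j x) * v).re : ℂ)
        = ((potential α j x).re : ℂ) * v.re + ((potential α j x).im : ℂ) * v.im := by
      rw [← Complex.ofReal_mul, ← Complex.ofReal_mul, ← Complex.ofReal_add]
      congr 1
      simp [Complex.mul_re]
    rw [this]
    linear_combination (-((v.re : ℂ) * fderiv ℝ u x (Pi.single j 1))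
      - (v.im : ℂ) * fderiv ℝ u x (Pi.single j Complex.I)) * (-hI)
  rw [key, norm_mul, Complex.norm_I, one_mul]
  refine (norm_real_combination_le _ _ _ _).trans (le_of_eq ?_)
  congr 1
  rw [Complex.norm_def, Complex.normSq_apply]
  ring_nf

theorem enorm_covariant_le (j : Fin N) (x : Fin N → ℂ) (v : ℂ) :
    ‖fderiv ℝ u x (Pi.single j v)
      + Complex.I * ((conj (potential α j x) * v).re : ℂ) * u x‖ₑ
      ≤ ‖v‖ₑ * covNorm α u j x := by
  rw [← ofReal_norm, ← ofReal_norm, covNorm, ← ENNReal.ofReal_mul (norm_nonneg _)]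
  exact ENNReal.ofReal_le_ofReal (norm_covariant_le j x v)

theorem measurable_covSq (hu : ContDiff ℝ (⊤ : ℕ∞) u) (j : Fin N) :
    Measurable (covSq α u j) := by
  have h1 : ∀ v : Fin N → ℂ, Measurable fun x => fderiv ℝ u x v := fun v =>
    ((hu.continuous_fderiv (by simp)).clm_apply continuous_const).measurable
  have h2 : Measurable u := hu.continuous.measurable
  have h3 : Measurable (potential α j) := by
    unfold potential
    fun_prop
  change Measurable fun x => ‖-Complex.I * fderiv ℝ u x (Pi.single j 1)
      + ((potential α j x).re : ℂ) * u x‖ ^ 2 +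
    ‖-Complex.I * fderiv ℝ u x (Pi.single j Complex.I)
      + ((potential α j x).im : ℂ) * u x‖ ^ 2
  have h4 := h1 (Pi.single j 1)
  have h5 := h1 (Pi.single j Complex.I)
  fun_prop

theorem measurable_covNorm (hu : ContDiff ℝ (⊤ : ℕ∞) u) (j : Fin N) :
    Measurable (covNorm α u j) :=
  ((measurable_covSq hu j).sqrt).ennreal_ofReal

end Pointwise

section Slicing

variable {N : ℕ}

theorem insertAt_self (j : Fin N) (y : ℂ) (z : {k : Fin N // k ≠ j} → ℂ) :
    insertAt j y z j = y := by simp [insertAt]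

theorem insertAt_of_ne (j : Fin N) (y : ℂ) (z : {k : Fin N // k ≠ j} → ℂ) {k : Fin N}
    (h : k ≠ j) : insertAt j y z k = z ⟨k, h⟩ := by simp [insertAt, h]

theorem measurable_insertAt (j : Fin N) :
    Measurable fun p : ℂ × ({k : Fin N // k ≠ j} → ℂ) => insertAt j p.1 p.2 := by
  refine measurable_pi_iff.2 fun k => ?_
  by_cases h : k = j
  · subst h
    simpa only [insertAt_self] using measurable_fst
  · simp only [insertAt_of_ne _ _ _ h]
    fun_prop

theorem lintegral_eq_lintegral_insertAt (j : Fin N) {F : (Fin N → ℂ) → ℝ≥0∞}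
    (hF : Measurable F) :
    ∫⁻ x, F x = ∫⁻ y : ℂ, ∫⁻ z : {k : Fin N // k ≠ j} → ℂ, F (insertAt j y z) := by
  have hm : Measurable fun p : ℂ × ({k : Fin N // k ≠ j} → ℂ) => F (insertAt j p.1 p.2) :=
    hF.comp (measurable_insertAt j)
  have e1 := volume_preserving_piEquivPiSubtypeProd (fun _ : Fin N => ℂ) (fun k => k = j)
  have e0 : ∀ inst : Fintype {k : Fin N // k = j},
      MeasurePreserving (MeasurableEquiv.funUnique {k : Fin N // k = j} ℂ)
        (@volume _ (@MeasureSpace.pi _ inst (fun _ => ℂ) _)) volume := by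
    intro inst
    obtain rfl := Subsingleton.elim inst Unique.fintype
    exact volume_preserving_funUnique {k : Fin N // k = j} ℂ
  have e2 := (e0 (Subtype.fintype fun k => k = j)).prod
    (MeasurePreserving.id (volume : Measure ({k : Fin N // k ≠ j} → ℂ)))
  rw [Measure.volume_eq_prod] at e1
  have e3 := e2.comp e1
  rw [← lintegral_prod _ hm.aemeasurable, ← Measure.volume_eq_prod]
  have := e3.lintegral_comp hm
  rw [← Measure.volume_eq_prod] at this
  rw [← this]
  refine lintegral_congr fun x => ?_
  congr 1
  funext k
  by_cases h : k = j
  · subst h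
    simp [insertAt]
    rfl
  · simp only [insertAt_of_ne _ _ _ h]
    rfl

theorem lintegral_eq_lintegral_insertAt' (j : Fin N) {F : (Fin N → ℂ) → ℝ≥0∞}
    (hF : Measurable F) :
    ∫⁻ x, F x = ∫⁻ z : {k : Fin N // k ≠ j} → ℂ, ∫⁻ y : ℂ, F (insertAt j y z) := by
  rw [lintegral_eq_lintegral_insertAt j hF]
  exact lintegral_lintegral_swap (hF.comp (measurable_insertAt j)).aemeasurable

theorem setLIntegral_eq_lintegral_insertAt (j : Fin N) {F : (Fin N → ℂ) → ℝ≥0∞}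
    (hF : Measurable F) {S : Set ℂ} (hS : MeasurableSet S) :
    ∫⁻ x in (fun x => x j) ⁻¹' S, F x
      = ∫⁻ y in S, ∫⁻ z : {k : Fin N // k ≠ j} → ℂ, F (insertAt j y z) := by
  have hS' : MeasurableSet ((fun x : Fin N → ℂ => x j) ⁻¹' S) := measurable_pi_apply j hS
  rw [← lintegral_indicator hS', ← lintegral_indicator hS,
    lintegral_eq_lintegral_insertAt j (hF.indicator hS')]
  refine lintegral_congr fun y => ?_
  by_cases hy : y ∈ S
  · simp [Set.indicator, hy, insertAt_self]
  · simp [Set.indicator, hy, insertAt_self]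

end Slicing

section Marginal

variable {N : ℕ}

/-- The sum of the one-particle marginals of `F j` in the `j`-th particle. -/
def marginal (F : Fin N → (Fin N → ℂ) → ℝ≥0∞) (y : ℂ) : ℝ≥0∞ :=
  ∑ j, ∫⁻ z : {k : Fin N // k ≠ j} → ℂ, F j (insertAt j y z)

theorem measurable_marginal {F : Fin N → (Fin N → ℂ) → ℝ≥0∞} (hF : ∀ j, Measurable (F j)) :
    Measurable (marginal F) :=
  Finset.measurable_sum _ fun j _ =>
    Measurable.lintegral_prod_right' ((hF j).comp (measurable_insertAt j))

theorem setLIntegral_marginal {F : Fin N → (Fin N → ℂ) → ℝ≥0∞} (hF : ∀ j, Measurable (F j))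
    {S : Set ℂ} (hS : MeasurableSet S) :
    ∫⁻ y in S, marginal F y = ∑ j, ∫⁻ x in (fun x => x j) ⁻¹' S, F j x := by
  unfold marginal
  rw [lintegral_finsetSum]
  · exact Finset.sum_congr rfl fun j _ => (setLIntegral_eq_lintegral_insertAt j (hF j) hS).symm
  · exact fun j _ => Measurable.lintegral_prod_right' ((hF j).comp (measurable_insertAt j))

/-- The one-particle density as an extended nonnegative function. -/
def edensity (u : (Fin N → ℂ) → ℂ) : ℂ → ℝ≥0∞ :=
  marginal fun _ x => ‖u x‖ₑ ^ 2

/-- A one-particle function controlling the gradient of the density. -/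
def gradBound (α : ℝ) (u : (Fin N → ℂ) → ℂ) : ℂ → ℝ≥0∞ :=
  marginal fun j x => 2 * ‖u x‖ₑ * covNorm α u j x

end Marginal

section Uncertainty

variable {N : ℕ} {α : ℝ} {u : (Fin N → ℂ) → ℂ}

theorem hasDerivAt_insertAt_line (j : Fin N) (p e : ℂ) (z : {k : Fin N // k ≠ j} → ℂ) (t : ℝ) :
    HasDerivAt (fun t : ℝ => insertAt j (p + t * e) z) (Pi.single j e) t := by
  rw [hasDerivAt_pi]
  intro k
  by_cases h : k = j
  · subst h
    simp only [insertAt_self, Pi.single_eq_same]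
    have := ((Complex.ofRealCLM.hasDerivAt (x := t)).mul_const e).const_add p
    simpa using this
  · simp only [insertAt_of_ne _ _ _ h, Pi.single_eq_of_ne h]
    exact hasDerivAt_const _ _

theorem contDiff_insertAt_line (j : Fin N) (p e : ℂ) (z : {k : Fin N // k ≠ j} → ℂ) :
    ContDiff ℝ 1 (fun t : ℝ => insertAt j (p + t * e) z) := by
  rw [contDiff_pi]
  intro k
  by_cases h : k = j
  · subst h
    simp only [insertAt_self]
    exact contDiff_const.add (Complex.ofRealCLM.contDiff.mul contDiff_const)
  · simp only [insertAt_of_ne _ _ _ h]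
    exact contDiff_const

theorem enorm_sq_le_add_lintegral (hu : ContDiff ℝ (⊤ : ℕ∞) u) (j : Fin N) (p e : ℂ)
    (he : ‖e‖ = 1) (z : {k : Fin N // k ≠ j} → ℂ) {a b s t : ℝ}
    (hs : s ∈ Set.Icc a b) (ht : t ∈ Set.Icc a b) :
    ‖u (insertAt j (p + s * e) z)‖ₑ ^ 2 ≤ ‖u (insertAt j (p + t * e) z)‖ₑ ^ 2
      + ∫⁻ r in Set.Ico a b, 2 * ‖u (insertAt j (p + r * e) z)‖ₑ
          * covNorm α u j (insertAt j (p + r * e) z) := by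
  set c : ℝ → (Fin N → ℂ) := fun r => insertAt j (p + r * e) z with hc
  set F : ℝ → ℝ := fun r => ‖u (c r)‖ ^ 2 with hF
  have hFC : ContDiff ℝ 1 F :=
    ((hu.of_le (by simp)).comp (contDiff_insertAt_line j p e z)).norm_sq ℝ
  have hderiv : ∀ r, ‖deriv F r‖ₑ ≤ 2 * ‖u (c r)‖ₑ * covNorm α u j (c r) := by
    intro r
    have h1 : HasDerivAt (fun r => u (c r)) (fderiv ℝ u (c r) (Pi.single j e)) r :=
      ((hu.differentiable (by simp)) (c r)).hasFDerivAt.comp_hasDerivAt r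
        (hasDerivAt_insertAt_line j p e z r)
    have h2 := h1.norm_sq
    rw [h2.deriv]
    set D := fderiv ℝ u (c r) (Pi.single j e)
    set τ : ℝ := (conj (potential α j (c r)) * e).re
    have h3 : inner ℝ (u (c r)) D = inner ℝ (u (c r)) (D + Complex.I * (τ : ℂ) * u (c r)) := by
      rw [inner_add_right]
      have : inner ℝ (u (c r)) (Complex.I * (τ : ℂ) * u (c r)) = 0 := by
        rw [Complex.inner]
        simp [Complex.mul_re, Complex.mul_im]
        ring
      rw [this, add_zero]
    have h4 : ‖D + Complex.I * (τ : ℂ) * u (c r)‖ ≤ Real.sqrt (covSq α u j (c r)) :=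
      (norm_covariant_le (α := α) (u := u) j (c r) e).trans_eq (by rw [he, one_mul])
    have h5 : ‖2 * inner ℝ (u (c r)) D‖
        ≤ 2 * ‖u (c r)‖ * Real.sqrt (covSq α u j (c r)) := by
      rw [h3, norm_mul, mul_assoc 2 ‖u (c r)‖]
      have := (norm_inner_le_norm (𝕜 := ℝ) (u (c r)) (D + Complex.I * (τ : ℂ) * u (c r)))
      rw [Real.norm_ofNat]
      exact mul_le_mul_of_nonneg_left
        (this.trans (mul_le_mul_of_nonneg_left h4 (norm_nonneg _))) (by norm_num)
    rw [← ofReal_norm, ← ofReal_norm, covNorm]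
    have h6 : (2 : ℝ≥0∞) = ENNReal.ofReal 2 := by simp
    rw [h6, ← ENNReal.ofReal_mul (by norm_num), ← ENNReal.ofReal_mul (by positivity)]
    exact ENNReal.ofReal_le_ofReal h5
  have main : ∀ s t : ℝ, a ≤ s → s ≤ t → t ≤ b →
      ‖F t - F s‖ₑ ≤ ∫⁻ r in Set.Ico a b, 2 * ‖u (c r)‖ₑ * covNorm α u j (c r) := by
    intro s t has hst htb
    refine (enorm_sub_le_lintegral_deriv_of_contDiffOn_Icc hFC.contDiffOn hst).trans ?_
    rw [setLIntegral_congr Ico_ae_eq_Icc]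
    exact (lintegral_mono hderiv).trans
      (lintegral_mono_set (Set.Icc_subset_Icc has htb))
  have hFe : ∀ r, ‖u (c r)‖ₑ ^ 2 = ‖F r‖ₑ := by
    intro r
    rw [hF]
    simp only [enorm_pow, enorm_norm]
  have hdiff : ‖F s - F t‖ₑ ≤ ∫⁻ r in Set.Ico a b, 2 * ‖u (c r)‖ₑ * covNorm α u j (c r) := by
    rcases le_total s t with h | h
    · rw [← neg_sub, enorm_neg]
      exact main s t hs.1 h ht.2
    · exact main t s ht.1 h hs.2
  change ‖u (c s)‖ₑ ^ 2 ≤ ‖u (c t)‖ₑ ^ 2 + _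
  rw [hFe, hFe]
  calc ‖F s‖ₑ = ‖F t + (F s - F t)‖ₑ := by congr 1; ring
    _ ≤ ‖F t‖ₑ + ‖F s - F t‖ₑ := enorm_add_le _ _
    _ ≤ _ := by gcongr

/-- Integral form of the fundamental theorem of calculus for the density along a line. -/
theorem edensity_le_line (hu : ContDiff ℝ (⊤ : ℕ∞) u) (p e : ℂ)
    (he : ‖e‖ = 1) {a b s t : ℝ} (hs : s ∈ Set.Icc a b) (ht : t ∈ Set.Icc a b) :
    edensity u (p + s * e) ≤ edensity u (p + t * e)
      + ∫⁻ r in Set.Ico a b, gradBound α u (p + r * e) := by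
  unfold edensity gradBound marginal
  have hm : ∀ j : Fin N, Measurable fun q : ℝ × ({k : Fin N // k ≠ j} → ℂ) =>
      2 * ‖u (insertAt j (p + q.1 * e) q.2)‖ₑ * covNorm α u j (insertAt j (p + q.1 * e) q.2) := by
    intro j
    have h1 : Measurable fun q : ℝ × ({k : Fin N // k ≠ j} → ℂ) =>
        insertAt j (p + q.1 * e) q.2 :=
      (measurable_insertAt j).comp (by fun_prop : Measurable fun q : ℝ × _ => (p + q.1 * e, q.2))
    have h2 := hu.continuous.measurable.comp h1
    have h3 := (measurable_covNorm (α := α) hu j).comp h1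
    exact (measurable_const.mul h2.enorm).mul h3
  rw [lintegral_finsetSum _ fun j _ => (hm j).lintegral_prod_right', ← Finset.sum_add_distrib]
  refine Finset.sum_le_sum fun j _ => ?_
  rw [lintegral_lintegral_swap (hm j).aemeasurable]
  rw [← lintegral_add_left]
  · exact lintegral_mono fun z => enorm_sq_le_add_lintegral hu j p e he z hs ht
  · have h1 : Measurable fun z : {k : Fin N // k ≠ j} → ℂ => insertAt j (p + t * e) z :=
      (measurable_insertAt j).comp (by fun_prop : Measurable fun z => (p + t * e, z))
    exact ((hu.continuous.measurable.comp h1).enorm).pow_const 2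

theorem measurable_edensity (hu : ContDiff ℝ (⊤ : ℕ∞) u) : Measurable (edensity u) :=
  measurable_marginal fun _ => hu.continuous.measurable.enorm.pow_const 2

theorem measurable_gradBound (hu : ContDiff ℝ (⊤ : ℕ∞) u) : Measurable (gradBound α u) :=
  measurable_marginal fun j =>
    (measurable_const.mul hu.continuous.measurable.enorm).mul (measurable_covNorm hu j)

theorem mul_edensity_le_line (hu : ContDiff ℝ (⊤ : ℕ∞) u) (p e : ℂ)
    (he : ‖e‖ = 1) {a b a' b' s : ℝ} (ha : a ≤ a') (hb : b' ≤ b) (hs : s ∈ Set.Icc a b) :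
    ENNReal.ofReal (b' - a') * edensity u (p + s * e)
      ≤ (∫⁻ t in Set.Ico a' b', edensity u (p + t * e))
      + ENNReal.ofReal (b' - a') * ∫⁻ r in Set.Ico a b, gradBound α u (p + r * e) := by
  have hm : Measurable fun t : ℝ => edensity u (p + t * e) :=
    (measurable_edensity hu).comp (by fun_prop)
  have h : ∀ c : ℝ≥0∞, ENNReal.ofReal (b' - a') * c = ∫⁻ _ in Set.Ico a' b', c := by
    intro c
    rw [setLIntegral_const, Real.volume_Ico, mul_comm]
  rw [h, h, ← lintegral_add_left hm]
  refine setLIntegral_mono' measurableSet_Ico fun t ht => ?_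
  exact edensity_le_line hu p e he hs ⟨ha.trans ht.1, ht.2.le.trans hb⟩

end Uncertainty

section Plane

theorem setLIntegral_reProdIm {f : ℂ → ℝ≥0∞} (hf : Measurable f) {A B : Set ℝ} :
    ∫⁻ z in A ×ℂ B, f z = ∫⁻ x in A, ∫⁻ y in B, f (x + y * Complex.I) := by
  have e := Complex.volume_preserving_equiv_real_prod.symm
  have hpre : Complex.measurableEquivRealProd.symm ⁻¹' (A ×ℂ B) = A ×ˢ B := by
    ext ⟨x, y⟩
    simp [Complex.mem_reProdIm]
  rw [← e.setLIntegral_comp_preimage_emb (MeasurableEquiv.measurableEmbedding _), hpre,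
    Measure.volume_eq_prod, ← Measure.prod_restrict, lintegral_prod]
  · refine lintegral_congr fun x => lintegral_congr fun y => ?_
    congr 1
    apply Complex.ext <;> simp
  · exact (hf.comp (MeasurableEquiv.measurable _)).aemeasurable

theorem setLIntegral_reProdIm_swap {f : ℂ → ℝ≥0∞} (hf : Measurable f) {A B : Set ℝ} :
    ∫⁻ z in A ×ℂ B, f z = ∫⁻ y in B, ∫⁻ x in A, f (x + y * Complex.I) := by
  rw [setLIntegral_reProdIm hf, lintegral_lintegral_swap]
  exact (hf.comp (by fun_prop : Measurable fun q : ℝ × ℝ =>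
    (q.1 : ℂ) + q.2 * Complex.I)).aemeasurable

theorem measurableSet_reProdIm {A B : Set ℝ} (hA : MeasurableSet A) (hB : MeasurableSet B) :
    MeasurableSet (A ×ℂ B) :=
  (Complex.measurable_re hA).inter (Complex.measurable_im hB)

end Plane

section Rectangles

variable {N : ℕ} {α : ℝ} {u : (Fin N → ℂ) → ℂ}

theorem edensity_le_re (hu : ContDiff ℝ (⊤ : ℕ∞) u) {a b a' b' s : ℝ} (ha : a ≤ a')
    (hb : b' ≤ b) (hs : s ∈ Set.Ico a b) (y : ℝ) :
    ENNReal.ofReal (b' - a') * edensity u (s + y * Complex.I)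
      ≤ (∫⁻ t in Set.Ico a' b', edensity u (t + y * Complex.I))
      + ENNReal.ofReal (b' - a') *
        ∫⁻ r in Set.Ico a b, gradBound α u (r + y * Complex.I) := by
  simpa [add_comm] using mul_edensity_le_line (α := α) hu (y * Complex.I) 1 (by simp) ha hb
    ⟨hs.1, hs.2.le⟩

theorem edensity_le_im (hu : ContDiff ℝ (⊤ : ℕ∞) u) {a b a' b' s : ℝ} (ha : a ≤ a')
    (hb : b' ≤ b) (hs : s ∈ Set.Ico a b) (x : ℝ) :
    ENNReal.ofReal (b' - a') * edensity u (x + s * Complex.I)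
      ≤ (∫⁻ t in Set.Ico a' b', edensity u (x + t * Complex.I))
      + ENNReal.ofReal (b' - a') *
        ∫⁻ r in Set.Ico a b, gradBound α u (x + r * Complex.I) :=
  mul_edensity_le_line (α := α) hu x Complex.I (by simp) ha hb ⟨hs.1, hs.2.le⟩

theorem mass_le_re_strip (hu : ContDiff ℝ (⊤ : ℕ∞) u) {a b a' b' : ℝ} (ha : a ≤ a')
    (hb : b' ≤ b) (J : Set ℝ) :
    ENNReal.ofReal (b' - a') * ∫⁻ z in Set.Ico a b ×ℂ J, edensity u z
      ≤ ENNReal.ofReal (b - a) * (∫⁻ z in Set.Ico a' b' ×ℂ J, edensity u z)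
      + ENNReal.ofReal (b - a) * (ENNReal.ofReal (b' - a') *
        ∫⁻ z in Set.Ico a b ×ℂ J, gradBound α u z) := by
  have hρ := measurable_edensity hu
  have hg := measurable_gradBound (α := α) hu
  have hρ₁ : ∀ K : Set ℝ, Measurable fun y : ℝ => ∫⁻ t in K, edensity u (t + y * Complex.I) :=
    fun K => Measurable.lintegral_prod_right'
      (f := fun q : ℝ × ℝ => edensity u ((q.2 : ℂ) + q.1 * Complex.I)) (by fun_prop)
  have hg₁ : ∀ K : Set ℝ, Measurable fun y : ℝ => ∫⁻ t in K, gradBound α u (t + y * Complex.I) :=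
    fun K => Measurable.lintegral_prod_right'
      (f := fun q : ℝ × ℝ => gradBound α u ((q.2 : ℂ) + q.1 * Complex.I)) (by fun_prop)
  rw [setLIntegral_reProdIm_swap hρ, setLIntegral_reProdIm_swap hρ,
    setLIntegral_reProdIm_swap hg, ← mul_add]
  rw [← lintegral_const_mul _ (hρ₁ _), ← lintegral_const_mul _ (hg₁ _),
    ← lintegral_add_left (hρ₁ _),
    ← lintegral_const_mul' (ENNReal.ofReal (b - a)) _ ENNReal.ofReal_ne_top]
  refine lintegral_mono fun y => ?_
  rw [← lintegral_const_mul _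
        (by fun_prop : Measurable fun t : ℝ => edensity u (t + y * Complex.I))]
  refine (setLIntegral_mono' measurableSet_Ico
    fun s hs => edensity_le_re (α := α) hu ha hb hs y).trans ?_
  rw [setLIntegral_const, Real.volume_Ico, mul_comm]

theorem mass_le_im_strip (hu : ContDiff ℝ (⊤ : ℕ∞) u) {a b a' b' : ℝ} (ha : a ≤ a')
    (hb : b' ≤ b) (J : Set ℝ) :
    ENNReal.ofReal (b' - a') * ∫⁻ z in J ×ℂ Set.Ico a b, edensity u z
      ≤ ENNReal.ofReal (b - a) * (∫⁻ z in J ×ℂ Set.Ico a' b', edensity u z)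
      + ENNReal.ofReal (b - a) * (ENNReal.ofReal (b' - a') *
        ∫⁻ z in J ×ℂ Set.Ico a b, gradBound α u z) := by
  have hρ := measurable_edensity hu
  have hg := measurable_gradBound (α := α) hu
  have hρ₁ : ∀ K : Set ℝ, Measurable fun x : ℝ => ∫⁻ t in K, edensity u (x + t * Complex.I) :=
    fun K => Measurable.lintegral_prod_right'
      (f := fun q : ℝ × ℝ => edensity u ((q.1 : ℂ) + q.2 * Complex.I)) (by fun_prop)
  have hg₁ : ∀ K : Set ℝ, Measurable fun x : ℝ => ∫⁻ t in K, gradBound α u (x + t * Complex.I) :=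
    fun K => Measurable.lintegral_prod_right'
      (f := fun q : ℝ × ℝ => gradBound α u ((q.1 : ℂ) + q.2 * Complex.I)) (by fun_prop)
  rw [setLIntegral_reProdIm hρ, setLIntegral_reProdIm hρ,
    setLIntegral_reProdIm hg, ← mul_add]
  rw [← lintegral_const_mul _ (hρ₁ _), ← lintegral_const_mul _ (hg₁ _),
    ← lintegral_add_left (hρ₁ _),
    ← lintegral_const_mul' (ENNReal.ofReal (b - a)) _ ENNReal.ofReal_ne_top]
  refine lintegral_mono fun x => ?_
  rw [← lintegral_const_mul _
        (by fun_prop : Measurable fun t : ℝ => edensity u (x + t * Complex.I))]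
  refine (setLIntegral_mono' measurableSet_Ico
    fun s hs => edensity_le_im (α := α) hu ha hb hs x).trans ?_
  rw [setLIntegral_const, Real.volume_Ico, mul_comm]

/-- A Ladyzhenskaya-type inequality for the density on a square. -/
theorem lintegral_edensity_sq_le (hu : ContDiff ℝ (⊤ : ℕ∞) u) (a b l : ℝ) :
    ENNReal.ofReal l ^ 2 *
        ∫⁻ z in Set.Ico a (a + l) ×ℂ Set.Ico b (b + l), edensity u z ^ 2
      ≤ ((∫⁻ z in Set.Ico a (a + l) ×ℂ Set.Ico b (b + l), edensity u z)
        + ENNReal.ofReal l *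
          ∫⁻ z in Set.Ico a (a + l) ×ℂ Set.Ico b (b + l), gradBound α u z) ^ 2 := by
  have hρ := measurable_edensity hu
  have hg := measurable_gradBound (α := α) hu
  have hm : Measurable fun q : ℝ × ℝ => (q.1 : ℂ) + q.2 * Complex.I := by fun_prop
  have hm' : Measurable fun q : ℝ × ℝ => (q.2 : ℂ) + q.1 * Complex.I := by fun_prop
  set I := Set.Ico a (a + l)
  set J := Set.Ico b (b + l)
  let E : ℂ → ℝ≥0∞ := fun z => edensity u z + ENNReal.ofReal l * gradBound α u z
  have hE : Measurable E := hρ.add (hg.const_mul _)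
  let E₁ : ℝ → ℝ≥0∞ := fun y => ∫⁻ t in I, E (t + y * Complex.I)
  let E₂ : ℝ → ℝ≥0∞ := fun x => ∫⁻ t in J, E (x + t * Complex.I)
  have hE₁ : Measurable E₁ := (hE.comp hm').lintegral_prod_right'
  have hE₂ : Measurable E₂ := (hE.comp hm).lintegral_prod_right'
  have b1 : ∀ x ∈ I, ∀ y : ℝ,
      ENNReal.ofReal l * edensity u (x + y * Complex.I) ≤ E₁ y := by
    intro x hx y
    have := edensity_le_re (α := α) hu le_rfl le_rfl hx y
    rw [add_sub_cancel_left] at this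
    refine this.trans_eq ?_
    simp only [E₁, E]
    rw [lintegral_add_left (by fun_prop : Measurable fun t : ℝ => edensity u (t + y * Complex.I)),
      lintegral_const_mul _
        (by fun_prop : Measurable fun t : ℝ => gradBound α u (t + y * Complex.I))]
  have b2 : ∀ y ∈ J, ∀ x : ℝ,
      ENNReal.ofReal l * edensity u (x + y * Complex.I) ≤ E₂ x := by
    intro y hy x
    have := edensity_le_im (α := α) hu le_rfl le_rfl hy x
    rw [add_sub_cancel_left] at this
    refine this.trans_eq ?_
    simp only [E₂, E]
    rw [lintegral_add_left (by fun_prop : Measurable fun t : ℝ => edensity u (x + t * Complex.I)),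
      lintegral_const_mul _
        (by fun_prop : Measurable fun t : ℝ => gradBound α u (x + t * Complex.I))]
  rw [← lintegral_const_mul _ hg, ← lintegral_add_left hρ, ← lintegral_const_mul _ (hρ.pow_const 2)]
  change _ ≤ (∫⁻ z in I ×ℂ J, E z) ^ 2
  calc ∫⁻ z in I ×ℂ J, ENNReal.ofReal l ^ 2 * edensity u z ^ 2
      = ∫⁻ x in I, ∫⁻ y in J, ENNReal.ofReal l ^ 2 * edensity u (x + y * Complex.I) ^ 2 :=
        setLIntegral_reProdIm ((hρ.pow_const 2).const_mul _)
    _ ≤ ∫⁻ x in I, ∫⁻ y in J, E₂ x * E₁ y := by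
        refine setLIntegral_mono' measurableSet_Ico fun x hx => ?_
        refine setLIntegral_mono' measurableSet_Ico fun y hy => ?_
        rw [← mul_pow, sq]
        exact mul_le_mul' (b2 y hy x) (b1 x hx y)
    _ = (∫⁻ x in I, E₂ x) * ∫⁻ y in J, E₁ y := by
        simp_rw [lintegral_const_mul _ hE₁]
        rw [lintegral_mul_const _ hE₂]
    _ = (∫⁻ z in I ×ℂ J, E z) ^ 2 := by
        rw [sq]
        nth_rw 1 [setLIntegral_reProdIm hE]
        rw [setLIntegral_reProdIm_swap hE]

/-- The kinetic energy carried by the particles located in `S`. -/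
def localEnergy (α : ℝ) (u : (Fin N → ℂ) → ℂ) (S : Set ℂ) : ℝ≥0∞ :=
  ∑ j, ∫⁻ x in (fun x => x j) ⁻¹' S, covNorm α u j x ^ 2

theorem lintegral_gradBound_le (hu : ContDiff ℝ (⊤ : ℕ∞) u) {S : Set ℂ} (hS : MeasurableSet S)
    {lam : ℝ} (hlam : 0 < lam) :
    ∫⁻ z in S, gradBound α u z ≤ ENNReal.ofReal lam * (∫⁻ z in S, edensity u z)
      + ENNReal.ofReal lam⁻¹ * localEnergy α u S := by
  have hum := hu.continuous.measurable.enorm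
  unfold gradBound edensity localEnergy
  have hcov := fun j => measurable_covNorm (α := α) hu j
  rw [setLIntegral_marginal (by fun_prop) hS, setLIntegral_marginal (by fun_prop) hS,
    Finset.mul_sum, Finset.mul_sum,
    ← Finset.sum_add_distrib]
  refine Finset.sum_le_sum fun j _ => ?_
  rw [← lintegral_const_mul _ (hum.pow_const 2),
    ← lintegral_const_mul _ ((measurable_covNorm hu j).pow_const 2),
    ← lintegral_add_left ((hum.pow_const 2).const_mul _)]
  refine lintegral_mono fun x => ?_
  rw [covNorm, ← ofReal_norm, ← ENNReal.ofReal_ofNat 2, ← ENNReal.ofReal_mul (by norm_num),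
    ← ENNReal.ofReal_mul (by positivity), ← ENNReal.ofReal_pow (by positivity),
    ← ENNReal.ofReal_pow (by positivity), ← ENNReal.ofReal_mul (by positivity),
    ← ENNReal.ofReal_mul (by positivity), ← ENNReal.ofReal_add (by positivity) (by positivity)]
  apply ENNReal.ofReal_le_ofReal
  have h1 : Real.sqrt lam ^ 2 = lam := Real.sq_sqrt hlam.le
  have h2 : (Real.sqrt lam)⁻¹ ^ 2 = lam⁻¹ := by rw [inv_pow, h1]
  have h3 : Real.sqrt lam * (Real.sqrt lam)⁻¹ = 1 :=
    mul_inv_cancel₀ (Real.sqrt_pos.2 hlam).ne'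
  have := sq_nonneg (Real.sqrt lam * ‖u x‖ - (Real.sqrt lam)⁻¹ * Real.sqrt (covSq α u j x))
  have e : (Real.sqrt lam * ‖u x‖ - (Real.sqrt lam)⁻¹ * Real.sqrt (covSq α u j x)) ^ 2
    = lam * ‖u x‖ ^ 2 + lam⁻¹ * Real.sqrt (covSq α u j x) ^ 2
      - 2 * ‖u x‖ * Real.sqrt (covSq α u j x) := by
    linear_combination ‖u x‖ ^ 2 * h1 + Real.sqrt (covSq α u j x) ^ 2 * h2
      - 2 * ‖u x‖ * Real.sqrt (covSq α u j x) * h3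
  linarith

end Rectangles

section Rotation

variable {N : ℕ}

/-- Rotation of the pair of particles `j`, `k` by the angle `φ` about their midpoint. -/
def rotatePair (j k : Fin N) (φ : ℝ) (x : Fin N → ℂ) : Fin N → ℂ := fun l =>
  if l = j then (x j + x k) / 2 + Complex.exp (φ * Complex.I) * ((x j - x k) / 2)
  else if l = k then (x j + x k) / 2 - Complex.exp (φ * Complex.I) * ((x j - x k) / 2)
  else x l

theorem rotatePair_left (j k : Fin N) (φ : ℝ) (x : Fin N → ℂ) : rotatePair j k φ x j =
    (x j + x k) / 2 + Complex.exp (φ * Complex.I) * ((x j - x k) / 2) := by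
  simp [rotatePair]

theorem rotatePair_right {j k : Fin N} (h : j ≠ k) (φ : ℝ) (x : Fin N → ℂ) :
    rotatePair j k φ x k =
      (x j + x k) / 2 - Complex.exp (φ * Complex.I) * ((x j - x k) / 2) := by
  simp [rotatePair, h.symm]

theorem rotatePair_of_ne {j k l : Fin N} (hj : l ≠ j) (hk : l ≠ k) (φ : ℝ) (x : Fin N → ℂ) :
    rotatePair j k φ x l = x l := by
  simp [rotatePair, hj, hk]

theorem rotatePair_add_eq {j k : Fin N} (h : j ≠ k) (φ : ℝ) (x : Fin N → ℂ) :
    rotatePair j k φ x j + rotatePair j k φ x k = x j + x k := by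
  rw [rotatePair_left, rotatePair_right h]; ring

theorem rotatePair_sub_eq {j k : Fin N} (h : j ≠ k) (φ : ℝ) (x : Fin N → ℂ) :
    rotatePair j k φ x j - rotatePair j k φ x k =
      Complex.exp (φ * Complex.I) * (x j - x k) := by
  rw [rotatePair_left, rotatePair_right h]; ring

theorem rotatePair_rotatePair {j k : Fin N} (h : j ≠ k) (φ ψ : ℝ) (x : Fin N → ℂ) :
    rotatePair j k φ (rotatePair j k ψ x) = rotatePair j k (φ + ψ) x := by
  have e : Complex.exp (((φ + ψ : ℝ) : ℂ) * Complex.I)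
      = Complex.exp (φ * Complex.I) * Complex.exp (ψ * Complex.I) := by
    rw [← Complex.exp_add]; push_cast; ring_nf
  funext l
  by_cases hj : l = j
  · subst hj
    rw [rotatePair_left, rotatePair_left _ _ (φ + ψ), rotatePair_add_eq h, rotatePair_sub_eq h, e]
    ring
  by_cases hk : l = k
  · subst hk
    rw [rotatePair_right h, rotatePair_right h (φ + ψ), rotatePair_add_eq h, rotatePair_sub_eq h, e]
    ring
  · rw [rotatePair_of_ne hj hk, rotatePair_of_ne hj hk, rotatePair_of_ne hj hk]

theorem rotatePair_zero {j k : Fin N} (x : Fin N → ℂ) : rotatePair j k 0 x = x := by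
  funext l
  by_cases hj : l = j
  · subst hj
    rw [rotatePair_left]; simp; ring
  by_cases hk : l = k
  · subst hk
    rw [rotatePair_right (Ne.symm hj)]; simp; ring
  · rw [rotatePair_of_ne hj hk]

theorem rotatePair_pi {j k : Fin N} (h : j ≠ k) (x : Fin N → ℂ) :
    rotatePair j k Real.pi x = x ∘ Equiv.swap j k := by
  funext l
  by_cases hj : l = j
  · subst hj
    rw [rotatePair_left, Complex.exp_pi_mul_I]; simp; ring
  by_cases hk : l = k
  · subst hk
    rw [rotatePair_right h, Complex.exp_pi_mul_I]; simp; ring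
  · rw [rotatePair_of_ne hj hk]; simp [Equiv.swap_apply_of_ne_of_ne hj hk]

theorem continuous_rotatePair (j k : Fin N) :
    Continuous fun p : ℝ × (Fin N → ℂ) => rotatePair j k p.1 p.2 := by
  refine continuous_pi fun l => ?_
  unfold rotatePair
  split_ifs <;> fun_prop

/-- `rotatePair` as a real-linear map. -/
def rotatePairLinear (j k : Fin N) (φ : ℝ) : (Fin N → ℂ) →ₗ[ℝ] (Fin N → ℂ) where
  toFun := rotatePair j k φ
  map_add' x y := by
    funext l
    simp only [rotatePair, Pi.add_apply]
    split_ifs <;> ring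
  map_smul' c x := by
    funext l
    simp only [rotatePair, Pi.smul_apply, RingHom.id_apply, Complex.real_smul]
    split_ifs <;> ring

theorem norm_rotatePair_le (j k : Fin N) (φ : ℝ) (x : Fin N → ℂ) :
    ‖rotatePair j k φ x‖ ≤ 2 * ‖x‖ := by
  have h1 : ∀ l, ‖x l‖ ≤ ‖x‖ := norm_le_pi_norm x
  have ha : ‖(x j + x k) / 2‖ ≤ ‖x‖ := by
    rw [norm_div, Complex.norm_ofNat]
    linarith [norm_add_le (x j) (x k), h1 j, h1 k]
  have hb : ‖Complex.exp (φ * Complex.I) * ((x j - x k) / 2)‖ ≤ ‖x‖ := by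
    rw [norm_mul, Complex.norm_exp_ofReal_mul_I, one_mul, norm_div, Complex.norm_ofNat]
    linarith [norm_sub_le (x j) (x k), h1 j, h1 k]
  refine (pi_norm_le_iff_of_nonneg (by positivity)).2 fun l => ?_
  unfold rotatePair
  split_ifs
  · linarith [norm_add_le ((x j + x k) / 2) (Complex.exp (φ * Complex.I) * ((x j - x k) / 2))]
  · linarith [norm_sub_le ((x j + x k) / 2) (Complex.exp (φ * Complex.I) * ((x j - x k) / 2))]
  · linarith [h1 l, norm_nonneg x]

theorem measurePreserving_rotatePair {j k : Fin N} (h : j ≠ k) (φ : ℝ) :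
    MeasurePreserving (rotatePair j k φ) := by
  set L := rotatePairLinear j k φ with hL
  have hcoe : ⇑L = rotatePair j k φ := rfl
  set S : Set (Fin N → ℂ) := {x | ∀ ψ : ℝ, ‖rotatePair j k ψ x‖ ≤ 1} with hS
  have himage : L '' S = S := by
    ext y
    constructor
    · rintro ⟨x, hx, rfl⟩ ψ
      rw [hcoe, rotatePair_rotatePair h]
      exact hx _
    · intro hy
      refine ⟨rotatePair j k (-φ) y, fun ψ => ?_, ?_⟩
      · rw [rotatePair_rotatePair h]
        exact hy _
      · rw [hcoe, rotatePair_rotatePair h, add_neg_cancel, rotatePair_zero]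
  have hpos : volume S ≠ 0 := by
    refine (measure_pos_of_superset (s := Metric.ball 0 (1 / 2)) ?_ ?_).ne'
    · intro x hx ψ
      have : ‖x‖ < 1 / 2 := by simpa using hx
      linarith [norm_rotatePair_le j k ψ x]
    · exact (Metric.measure_ball_pos _ _ (by norm_num)).ne'
  have hfin : volume S ≠ ∞ := by
    refine ne_top_of_le_ne_top (measure_closedBall_lt_top (x := (0 : Fin N → ℂ)) (r := 1)).ne
      (measure_mono fun x hx => ?_)
    have := hx 0
    rw [rotatePair_zero] at this
    simpa using this
  have hdet : ENNReal.ofReal |LinearMap.det L| = 1 := by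
    have := Measure.addHaar_image_linearMap volume L S
    rw [himage] at this
    have h2 : 1 * volume S = ENNReal.ofReal |LinearMap.det L| * volume S := by rwa [one_mul]
    exact ((ENNReal.mul_left_inj hpos hfin).1 h2).symm
  have habs : |LinearMap.det L| = 1 := by
    simpa using hdet
  refine ⟨(continuous_rotatePair j k).comp (by fun_prop : Continuous fun x => (φ, x))
    |>.measurable, ?_⟩
  have hne : LinearMap.det L ≠ 0 := by
    intro h0
    rw [h0] at habs
    simp at habs
  have := Measure.map_linearMap_addHaar_eq_smul_addHaar volume hne
  rw [abs_inv, habs, hcoe] at this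
  simpa using this

end Rotation

section StatisticsConstant

theorem bddBelow_statC (α : ℝ) (p : ℝ) :
    BddBelow (Set.range fun q : ℤ => |(2 * p + 1) * α - 2 * (q : ℝ)|) :=
  ⟨0, by rintro _ ⟨q, rfl⟩; positivity⟩

theorem statC_nonneg (α : ℝ) (N : ℕ) : 0 ≤ statC α N :=
  Real.iInf_nonneg fun _ => Real.iInf_nonneg fun _ => abs_nonneg _

theorem statC_le {α : ℝ} {N p : ℕ} (hp : p < N - 1) (q : ℤ) :
    statC α N ≤ |(2 * (p : ℝ) + 1) * α - 2 * (q : ℝ)| := by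
  unfold statC
  refine (ciInf_le ⟨0, ?_⟩ (⟨p, hp⟩ : Fin (N - 1))).trans (ciInf_le (bddBelow_statC α p) q)
  rintro _ ⟨p, rfl⟩
  exact Real.iInf_nonneg fun _ => abs_nonneg _

theorem abs_sub_two_mul_round_le (β : ℝ) : |β - 2 * (round (β / 2) : ℝ)| ≤ 1 := by
  have := abs_sub_round (β / 2)
  have e : β - 2 * (round (β / 2) : ℝ) = 2 * (β / 2 - round (β / 2)) := by ring
  rw [e, abs_mul, abs_two]
  linarith

theorem statC_le_one {α : ℝ} {N : ℕ} (hN : 2 ≤ N) : statC α N ≤ 1 :=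
  (statC_le (p := 0) (by omega) (round ((2 * ((0 : ℕ) : ℝ) + 1) * α / 2))).trans
    (abs_sub_two_mul_round_le _)

theorem two_mul_abs_le_norm_exp_sub_one (β : ℝ) :
    2 * |β - 2 * (round (β / 2) : ℝ)| ≤ ‖Complex.exp (Complex.I * (Real.pi * β : ℝ)) - 1‖ := by
  set δ := β - 2 * (round (β / 2) : ℝ) with hδ
  have hδ1 : |δ| ≤ 1 := abs_sub_two_mul_round_le β
  have e : Complex.exp (Complex.I * (Real.pi * β : ℝ))
      = Complex.exp (Complex.I * (Real.pi * δ : ℝ)) := by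
    rw [Complex.exp_eq_exp_iff_exists_int]
    refine ⟨round (β / 2), ?_⟩
    rw [hδ]
    push_cast
    ring
  rw [e, Complex.norm_exp_I_mul_ofReal_sub_one, Real.norm_eq_abs, abs_mul, abs_two]
  have h1 := Real.mul_le_sin (x := Real.pi * |δ| / 2) (by positivity)
    (by nlinarith [Real.pi_pos])
  have h2 : 2 / Real.pi * (Real.pi * |δ| / 2) = |δ| := by
    field_simp
  have h3 : |Real.sin (Real.pi * δ / 2)| ≥ Real.sin (Real.pi * |δ| / 2) := by
    rcases abs_cases δ with ⟨h, _⟩ | ⟨h, _⟩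
    · rw [h]; exact le_abs_self _
    · rw [h, mul_neg, neg_div, Real.sin_neg]; exact neg_le_abs _
  linarith

theorem two_mul_statC_le {α : ℝ} {N p : ℕ} (hp : p < N - 1) :
    2 * statC α N ≤
      ‖Complex.exp (Complex.I * (Real.pi * ((2 * (p : ℝ) + 1) * α) : ℝ)) - 1‖ :=
  (mul_le_mul_of_nonneg_left (statC_le hp _) zero_le_two).trans
    (two_mul_abs_le_norm_exp_sub_one _)

end StatisticsConstant

section Flux

theorem exp_ne_of_norm_ne {ζ : ℂ} (hζ : ‖ζ‖ ≠ 1) (φ : ℝ) :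
    Complex.exp (φ * Complex.I) - ζ ≠ 0 := by
  intro h
  rw [sub_eq_zero] at h
  apply hζ
  rw [← h, Complex.norm_exp_ofReal_mul_I]

theorem integral_exp_div_sub {ζ : ℂ} (hζ : ‖ζ‖ ≠ 1) :
    ∫ φ in (0 : ℝ)..2 * Real.pi,
      Complex.exp (φ * Complex.I) / (Complex.exp (φ * Complex.I) - ζ)
      = if ‖ζ‖ < 1 then 2 * Real.pi else 0 := by
  have key : (∮ v in C(0, 1), (v - ζ)⁻¹) = Complex.I * ∫ φ in (0 : ℝ)..2 * Real.pi,
      Complex.exp (φ * Complex.I) / (Complex.exp (φ * Complex.I) - ζ) := by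
    rw [circleIntegral, ← intervalIntegral.integral_const_mul]
    refine intervalIntegral.integral_congr fun φ _ => ?_
    simp only [deriv_circleMap, circleMap, smul_eq_mul]
    simp
    ring
  split_ifs with h
  · rw [circleIntegral.integral_sub_inv_of_mem_ball (by simpa using h)] at key
    refine mul_left_cancel₀ Complex.I_ne_zero ?_
    rw [← key]
    push_cast
    ring
  · have h1 : 1 < ‖ζ‖ := lt_of_le_of_ne (not_lt.1 h) hζ.symm
    have h0 : (∮ v in C(0, 1), (v - ζ)⁻¹) = 0 := by
      refine DiffContOnCl.circleIntegral_eq_zero zero_le_one ?_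
      refine DifferentiableOn.diffContOnCl ?_
      intro v hv
      have hv' : ‖v‖ ≤ 1 := by
        simpa using Metric.closure_ball_subset_closedBall hv
      have : v - ζ ≠ 0 := by
        intro h
        rw [sub_eq_zero] at h
        rw [h] at hv'
        linarith
      exact ((differentiableAt_id.sub_const ζ).inv this).differentiableWithinAt
    rw [h0] at key
    exact (mul_eq_zero.1 key.symm).resolve_left Complex.I_ne_zero

theorem integral_exp_div_sub_add {ζ : ℂ} (hζ : ‖ζ‖ ≠ 1) :
    ∫ φ in (0 : ℝ)..Real.pi,
      (Complex.exp (φ * Complex.I) / (Complex.exp (φ * Complex.I) - ζ)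
        + Complex.exp (φ * Complex.I) / (Complex.exp (φ * Complex.I) + ζ))
      = if ‖ζ‖ < 1 then 2 * Real.pi else 0 := by
  have hc : Continuous fun φ : ℝ =>
      Complex.exp (φ * Complex.I) / (Complex.exp (φ * Complex.I) - ζ) :=
    Continuous.div (by fun_prop) (by fun_prop) (exp_ne_of_norm_ne hζ)
  have hs : ∀ φ : ℝ, Complex.exp (φ * Complex.I) / (Complex.exp (φ * Complex.I) + ζ)
      = Complex.exp ((φ + Real.pi : ℝ) * Complex.I)
        / (Complex.exp ((φ + Real.pi : ℝ) * Complex.I) - ζ) := by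
    intro φ
    have : Complex.exp ((φ + Real.pi : ℝ) * Complex.I) = -Complex.exp (φ * Complex.I) := by
      push_cast
      rw [add_mul, Complex.exp_add, Complex.exp_pi_mul_I]
      ring
    rw [this, ← neg_add', neg_div_neg_eq]
  rw [← integral_exp_div_sub hζ]
  simp_rw [hs]
  have hc' : Continuous fun φ : ℝ => Complex.exp ((φ + Real.pi : ℝ) * Complex.I)
      / (Complex.exp ((φ + Real.pi : ℝ) * Complex.I) - ζ) :=
    hc.comp (continuous_id.add continuous_const)
  rw [intervalIntegral.integral_add (hc.intervalIntegrable _ _) (hc'.intervalIntegrable _ _)]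
  rw [intervalIntegral.integral_comp_add_right (fun φ : ℝ =>
      Complex.exp (φ * Complex.I) / (Complex.exp (φ * Complex.I) - ζ)), zero_add, ← two_mul]
  exact intervalIntegral.integral_add_adjacent_intervals (hc.intervalIntegrable _ _)
    (hc.intervalIntegrable _ _)

end Flux

section Pair

variable {N : ℕ} {α : ℝ} {u : (Fin N → ℂ) → ℂ}

theorem conj_potential (j : Fin N) (x : Fin N → ℂ) :
    conj (potential α j x)
      = α * ∑ l ∈ Finset.univ.erase j, -Complex.I / (x j - x l) := by
  unfold potential
  rw [map_mul, map_sum, Complex.conj_ofReal]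
  congr 1
  refine Finset.sum_congr rfl fun l _ => ?_
  by_cases h : x j - x l = 0
  · simp [h]
  · have h2 : conj (x j - x l) ≠ 0 := (map_ne_zero _).2 h
    rw [map_div₀, map_mul, Complex.conj_I, map_pow, Complex.conj_ofReal, ← Complex.mul_conj']
    field_simp

theorem hasDerivAt_rotatePair {j k : Fin N} (h : j ≠ k) (x : Fin N → ℂ) (φ : ℝ) :
    HasDerivAt (fun φ => rotatePair j k φ x)
      (Pi.single j (Complex.I * (Complex.exp (φ * Complex.I) * ((x j - x k) / 2)))
        + Pi.single k (-(Complex.I * (Complex.exp (φ * Complex.I) * ((x j - x k) / 2))))) φ := by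
  have h0 : HasDerivAt (fun φ : ℝ => Complex.exp (φ * Complex.I) * ((x j - x k) / 2))
      (Complex.I * (Complex.exp (φ * Complex.I) * ((x j - x k) / 2))) φ := by
    have h1 : HasDerivAt (fun φ : ℝ => (φ : ℂ) * Complex.I) Complex.I φ := by
      simpa using (Complex.ofRealCLM.hasDerivAt (x := φ)).mul_const Complex.I
    exact (h1.cexp.mul_const ((x j - x k) / 2)).congr_deriv (by ring)
  rw [hasDerivAt_pi]
  intro l
  by_cases hj : l = j
  · subst hj
    simp only [rotatePair_left, Pi.add_apply, Pi.single_eq_same, Pi.single_eq_of_ne h, add_zero]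
    exact h0.const_add _
  by_cases hk : l = k
  · subst hk
    simp only [rotatePair_right h, Pi.add_apply, Pi.single_eq_same, Pi.single_eq_of_ne hj,
      zero_add]
    exact h0.const_sub _
  · simp only [rotatePair_of_ne hj hk, Pi.add_apply, Pi.single_eq_of_ne hj,
      Pi.single_eq_of_ne hk, add_zero]
    exact hasDerivAt_const _ _

/-- The component of the magnetic potential along the rotation of the pair `j`, `k`. -/
def angularPotential (α : ℝ) (j k : Fin N) (x : Fin N → ℂ) (φ : ℝ) : ℝ :=
  (conj (potential α j (rotatePair j k φ x))
    * (Complex.I * (Complex.exp (φ * Complex.I) * ((x j - x k) / 2)))).re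
  + (conj (potential α k (rotatePair j k φ x))
    * (-(Complex.I * (Complex.exp (φ * Complex.I) * ((x j - x k) / 2))))).re

theorem angularPotential_eq {j k : Fin N} (h : j ≠ k) {x : Fin N → ℂ} (hx : x j ≠ x k)
    (φ : ℝ) :
    angularPotential α j k x φ = α * (1 + ∑ l ∈ (Finset.univ.erase j).erase k,
      (Complex.exp (φ * Complex.I) / (Complex.exp (φ * Complex.I)
          - (x l - (x j + x k) / 2) / ((x j - x k) / 2))
        + Complex.exp (φ * Complex.I) / (Complex.exp (φ * Complex.I)
          + (x l - (x j + x k) / 2) / ((x j - x k) / 2))).re) := by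
  have hw0 : (x j - x k) / 2 ≠ 0 := div_ne_zero (sub_ne_zero.2 hx) two_ne_zero
  have hexp : Complex.exp (φ * Complex.I) ≠ 0 := Complex.exp_ne_zero _
  have hI := Complex.I_mul_I
  have e1 : conj (potential α j (rotatePair j k φ x))
      * (Complex.I * (Complex.exp (φ * Complex.I) * ((x j - x k) / 2)))
      = α * (1 / 2 + ∑ l ∈ (Finset.univ.erase j).erase k,
        Complex.exp (φ * Complex.I) / (Complex.exp (φ * Complex.I)
          - (x l - (x j + x k) / 2) / ((x j - x k) / 2))) := by
    rw [conj_potential, mul_assoc, Finset.sum_mul,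
      ← Finset.add_sum_erase _ _ (Finset.mem_erase.2 ⟨h.symm, Finset.mem_univ k⟩)]
    congr 2
    · rw [rotatePair_sub_eq h]
      have : x j - x k ≠ 0 := sub_ne_zero.2 hx
      field_simp
      linear_combination -hI
    · refine Finset.sum_congr rfl fun l hl => ?_
      have hlk : l ≠ k := Finset.ne_of_mem_erase hl
      have hlj : l ≠ j := Finset.ne_of_mem_erase (Finset.mem_of_mem_erase hl)
      rw [rotatePair_of_ne hlj hlk, rotatePair_left]
      set w := (x j - x k) / 2
      set X := (x j + x k) / 2
      set E := Complex.exp (φ * Complex.I)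
      have : E - (x l - X) / w = (X + E * w - x l) / w := by
        field_simp
        ring
      rw [this, div_div_eq_mul_div, div_mul_eq_mul_div]
      congr 1
      linear_combination (-E * w) * hI
  have e2 : conj (potential α k (rotatePair j k φ x))
      * (-(Complex.I * (Complex.exp (φ * Complex.I) * ((x j - x k) / 2))))
      = α * (1 / 2 + ∑ l ∈ (Finset.univ.erase j).erase k,
        Complex.exp (φ * Complex.I) / (Complex.exp (φ * Complex.I)
          + (x l - (x j + x k) / 2) / ((x j - x k) / 2))) := by
    rw [conj_potential, mul_assoc, Finset.sum_mul,
      ← Finset.add_sum_erase _ _ (Finset.mem_erase.2 ⟨h, Finset.mem_univ j⟩),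
      Finset.erase_right_comm]
    congr 2
    · rw [← neg_sub (rotatePair j k φ x j), rotatePair_sub_eq h]
      have : x j - x k ≠ 0 := sub_ne_zero.2 hx
      field_simp
      linear_combination -hI
    · refine Finset.sum_congr rfl fun l hl => ?_
      have hlk : l ≠ k := Finset.ne_of_mem_erase hl
      have hlj : l ≠ j := Finset.ne_of_mem_erase (Finset.mem_of_mem_erase hl)
      rw [rotatePair_of_ne hlj hlk, rotatePair_right h]
      set w := (x j - x k) / 2
      set X := (x j + x k) / 2
      set E := Complex.exp (φ * Complex.I)
      have : E + (x l - X) / w = -(X - E * w - x l) / w := by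
        field_simp
        ring
      rw [this, div_div_eq_mul_div, div_mul_eq_mul_div, div_neg, ← neg_div]
      congr 1
      linear_combination (E * w) * hI
  have e3 : (angularPotential α j k x φ : ℝ) = (α * (1 + ∑ l ∈ (Finset.univ.erase j).erase k,
      (Complex.exp (φ * Complex.I) / (Complex.exp (φ * Complex.I)
          - (x l - (x j + x k) / 2) / ((x j - x k) / 2))
        + Complex.exp (φ * Complex.I) / (Complex.exp (φ * Complex.I)
          + (x l - (x j + x k) / 2) / ((x j - x k) / 2)))) : ℂ).re := by
    unfold angularPotential
    rw [e1, e2, ← Complex.add_re, Finset.sum_add_distrib]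
    congr 1
    ring
  rw [e3, Complex.re_ofReal_mul, Complex.add_re, Complex.one_re, Complex.re_sum]

end Pair

section Pair

variable {N : ℕ} {α : ℝ} {u : (Fin N → ℂ) → ℂ}

theorem norm_relative_ne {j k : Fin N} {x : Fin N → ℂ} (hx : x j ≠ x k) {l : Fin N}
    (hl : ‖x l - (x j + x k) / 2‖ ≠ ‖(x j - x k) / 2‖) :
    ‖(x l - (x j + x k) / 2) / ((x j - x k) / 2)‖ ≠ 1 := by
  have hw0 : (x j - x k) / 2 ≠ 0 := div_ne_zero (sub_ne_zero.2 hx) two_ne_zero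
  rw [norm_div]
  intro h
  exact hl ((div_eq_one_iff_eq (norm_ne_zero_iff.2 hw0)).1 h)

theorem continuous_exp_div_sub_add {ζ : ℂ} (hζ : ‖ζ‖ ≠ 1) : Continuous fun φ : ℝ =>
    (Complex.exp (φ * Complex.I) / (Complex.exp (φ * Complex.I) - ζ)
        + Complex.exp (φ * Complex.I) / (Complex.exp (φ * Complex.I) + ζ)) := by
  refine Continuous.add (Continuous.div (by fun_prop) (by fun_prop) (exp_ne_of_norm_ne hζ))
    (Continuous.div (by fun_prop) (by fun_prop) fun φ => ?_)
  rw [← sub_neg_eq_add]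
  exact exp_ne_of_norm_ne (by rwa [norm_neg]) φ

theorem continuous_angularPotential {j k : Fin N} (h : j ≠ k) {x : Fin N → ℂ}
    (hx : x j ≠ x k)
    (hne : ∀ l, l ≠ j → l ≠ k → ‖x l - (x j + x k) / 2‖ ≠ ‖(x j - x k) / 2‖) :
    Continuous (angularPotential α j k x) := by
  have e : angularPotential α j k x = _ := funext fun φ => angularPotential_eq h hx φ
  rw [e]
  refine continuous_const.mul (continuous_const.add (continuous_finsetSum _ fun l hl => ?_))
  have hlk : l ≠ k := Finset.ne_of_mem_erase hl
  have hlj : l ≠ j := Finset.ne_of_mem_erase (Finset.mem_of_mem_erase hl)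
  exact Complex.continuous_re.comp
    (continuous_exp_div_sub_add (norm_relative_ne hx (hne l hlj hlk)))

theorem integral_angularPotential {j k : Fin N} (h : j ≠ k) {x : Fin N → ℂ}
    (hx : x j ≠ x k)
    (hne : ∀ l, l ≠ j → l ≠ k → ‖x l - (x j + x k) / 2‖ ≠ ‖(x j - x k) / 2‖) :
    ∃ p : ℕ, p < N - 1 ∧
      ∫ φ in (0 : ℝ)..Real.pi, angularPotential α j k x φ
        = Real.pi * ((2 * (p : ℝ) + 1) * α) := by
  set s := (Finset.univ.erase j).erase k with hs
  have hne' : ∀ l ∈ s, ‖(x l - (x j + x k) / 2) / ((x j - x k) / 2)‖ ≠ 1 := fun l hl =>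
    norm_relative_ne hx (hne l (Finset.ne_of_mem_erase (Finset.mem_of_mem_erase hl))
      (Finset.ne_of_mem_erase hl))
  refine ⟨(s.filter fun l => ‖(x l - (x j + x k) / 2) / ((x j - x k) / 2)‖ < 1).card, ?_, ?_⟩
  · have h1 : s.card = N - 1 - 1 := by
      rw [hs, Finset.card_erase_of_mem (Finset.mem_erase.2 ⟨h.symm, Finset.mem_univ k⟩),
        Finset.card_erase_of_mem (Finset.mem_univ j), Finset.card_univ, Fintype.card_fin]
    have h2 := Finset.card_filter_le s
      fun l => ‖(x l - (x j + x k) / 2) / ((x j - x k) / 2)‖ < 1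
    have h3 : (j : ℕ) ≠ k := fun e => h (Fin.ext e)
    have := j.2
    have := k.2
    omega
  · have hint : ∀ l ∈ s, IntervalIntegrable (fun φ : ℝ =>
        (Complex.exp (φ * Complex.I) / (Complex.exp (φ * Complex.I)
            - (x l - (x j + x k) / 2) / ((x j - x k) / 2))
          + Complex.exp (φ * Complex.I) / (Complex.exp (φ * Complex.I)
            + (x l - (x j + x k) / 2) / ((x j - x k) / 2)))) volume 0 Real.pi := fun l hl =>
      (continuous_exp_div_sub_add (hne' l hl)).intervalIntegrable _ _
    have hre : ∀ l ∈ s, IntervalIntegrable (fun φ : ℝ =>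
        (Complex.exp (φ * Complex.I) / (Complex.exp (φ * Complex.I)
            - (x l - (x j + x k) / 2) / ((x j - x k) / 2))
          + Complex.exp (φ * Complex.I) / (Complex.exp (φ * Complex.I)
            + (x l - (x j + x k) / 2) / ((x j - x k) / 2))).re) volume 0 Real.pi := fun l hl =>
      (Complex.continuous_re.comp
        (continuous_exp_div_sub_add (hne' l hl))).intervalIntegrable _ _
    simp_rw [angularPotential_eq h hx, ← hs]
    have hsum := IntervalIntegrable.sum s hre
    simp only [Finset.sum_fn] at hsum
    rw [intervalIntegral.integral_const_mul, intervalIntegral.integral_add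
      intervalIntegrable_const hsum, intervalIntegral.integral_finsetSum hre]
    have : ∀ l ∈ s, ∫ φ in (0 : ℝ)..Real.pi,
        (Complex.exp (φ * Complex.I) / (Complex.exp (φ * Complex.I)
            - (x l - (x j + x k) / 2) / ((x j - x k) / 2))
          + Complex.exp (φ * Complex.I) / (Complex.exp (φ * Complex.I)
            + (x l - (x j + x k) / 2) / ((x j - x k) / 2))).re
        = if ‖(x l - (x j + x k) / 2) / ((x j - x k) / 2)‖ < 1 then 2 * Real.pi else 0 := by
      intro l hl
      have h1 := Complex.reCLM.intervalIntegral_comp_comm (hint l hl)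
      simp only [Complex.reCLM_apply] at h1
      rw [h1, integral_exp_div_sub_add (hne' l hl)]
      simp
    rw [Finset.sum_congr rfl this, ← Finset.sum_filter, Finset.sum_const]
    simp
    ring

theorem pair_inequality (hu : IsAnyonWF N u) {j k : Fin N} (h : j ≠ k) {x : Fin N → ℂ}
    (hne : ∀ l, l ≠ j → l ≠ k → ‖x l - (x j + x k) / 2‖ ≠ ‖(x j - x k) / 2‖) :
    ENNReal.ofReal (2 * statC α N) * ‖u x‖ₑ ≤
      ∫⁻ φ in Set.Icc 0 Real.pi, ‖(x j - x k) / 2‖ₑ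
        * (covNorm α u j (rotatePair j k φ x) + covNorm α u k (rotatePair j k φ x)) := by
  by_cases hx : x j = x k
  · have : u x = 0 := image_eq_zero_of_notMem_tsupport fun hm => hu.offDiagonal x hm j k h hx
    simp [this]
  obtain ⟨p, hp, hint⟩ := integral_angularPotential (α := α) h hx hne
  have hac := continuous_angularPotential (α := α) h hx hne
  set a := angularPotential α j k x with ha
  set A : ℝ → ℝ := fun φ => ∫ t in (0 : ℝ)..φ, a t with hA
  have hAd : ∀ φ, HasDerivAt A (a φ) φ := fun φ =>
    intervalIntegral.integral_hasDerivAt_right (hac.intervalIntegrable _ _)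
      (hac.stronglyMeasurableAtFilter _ _) hac.continuousAt
  have hAc : Continuous A := continuous_iff_continuousAt.2 fun φ => (hAd φ).continuousAt
  set v : ℝ → ℂ := fun φ => Complex.I * (Complex.exp (φ * Complex.I) * ((x j - x k) / 2))
    with hv
  have hvc : Continuous v := by fun_prop
  have hrot : Continuous fun φ => rotatePair j k φ x :=
    (continuous_rotatePair j k).comp (by fun_prop : Continuous fun φ : ℝ => (φ, x))
  set V : ℝ → Fin N → ℂ := fun φ => Pi.single j (v φ) + Pi.single k (-(v φ)) with hV
  have hVc : Continuous V :=
    ((continuous_single j).comp hvc).add ((continuous_single k).comp hvc.neg)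
  set g : ℝ → ℂ := fun φ => Complex.exp (Complex.I * A φ) * u (rotatePair j k φ x) with hg
  set g' : ℝ → ℂ := fun φ => Complex.exp (Complex.I * A φ) *
    (fderiv ℝ u (rotatePair j k φ x) (V φ) + Complex.I * a φ * u (rotatePair j k φ x)) with hg'
  have hgd : ∀ φ, HasDerivAt g (g' φ) φ := by
    intro φ
    have h1 : HasDerivAt (fun φ => Complex.exp (Complex.I * A φ))
        (Complex.exp (Complex.I * A φ) * (Complex.I * a φ)) φ :=
      ((hAd φ).ofReal_comp.const_mul Complex.I).cexp
    have h2 : HasDerivAt (fun φ => u (rotatePair j k φ x))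
        (fderiv ℝ u (rotatePair j k φ x) (V φ)) φ :=
      ((hu.smooth.differentiable (by simp)) _).hasFDerivAt.comp_hasDerivAt φ
        (hasDerivAt_rotatePair h x φ)
    exact (h1.mul h2).congr_deriv (by rw [hg']; ring)
  have hgc : Continuous g' := by
    have h3 : Continuous fun φ => fderiv ℝ u (rotatePair j k φ x) (V φ) :=
      ((hu.smooth.continuous_fderiv (by simp)).comp hrot).clm_apply hVc
    have h4 : Continuous fun φ => u (rotatePair j k φ x) := hu.smooth.continuous.comp hrot
    have h5 : Continuous fun φ => Complex.exp (Complex.I * A φ) :=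
      (continuous_const.mul (Complex.continuous_ofReal.comp hAc)).cexp
    exact h5.mul (h3.add ((continuous_const.mul (Complex.continuous_ofReal.comp hac)).mul h4))
  have hgC : ContDiff ℝ 1 g := by
    rw [contDiff_one_iff_deriv]
    refine ⟨fun φ => (hgd φ).differentiableAt, ?_⟩
    have : deriv g = g' := funext fun φ => (hgd φ).deriv
    rwa [this]
  have hmain := enorm_sub_le_lintegral_deriv_of_contDiffOn_Icc
    (hgC.contDiffOn (s := Set.Icc 0 Real.pi)) Real.pi_pos.le
  have hg0 : g 0 = u x := by
    simp [hg, hA, rotatePair_zero]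
  have hgpi : g Real.pi = Complex.exp (Complex.I * (Real.pi * ((2 * (p : ℝ) + 1) * α) : ℝ))
      * u x := by
    simp only [hg, rotatePair_pi h, hu.symmetric]
    rw [← hint]
  rw [hg0, hgpi, ← sub_one_mul, enorm_mul] at hmain
  calc ENNReal.ofReal (2 * statC α N) * ‖u x‖ₑ
      ≤ ‖Complex.exp (Complex.I * (Real.pi * ((2 * (p : ℝ) + 1) * α) : ℝ)) - 1‖ₑ
          * ‖u x‖ₑ := by
        gcongr
        rw [← ofReal_norm]
        exact ENNReal.ofReal_le_ofReal (two_mul_statC_le hp)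
    _ ≤ _ := hmain
    _ ≤ _ := by
        refine lintegral_mono fun φ => ?_
        dsimp only
        rw [(hgd φ).deriv, hg', enorm_mul]
        have h5 : ‖Complex.exp (Complex.I * A φ)‖ₑ = 1 := by
          rw [mul_comm, ← ofReal_norm, Complex.norm_exp_ofReal_mul_I, ENNReal.ofReal_one]
        rw [h5, one_mul]
        have h6 : fderiv ℝ u (rotatePair j k φ x) (V φ)
            + Complex.I * a φ * u (rotatePair j k φ x)
            = (fderiv ℝ u (rotatePair j k φ x) (Pi.single j (v φ))
              + Complex.I * ((conj (potential α j (rotatePair j k φ x)) * v φ).re : ℂ)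
                * u (rotatePair j k φ x))
            + (fderiv ℝ u (rotatePair j k φ x) (Pi.single k (-(v φ)))
              + Complex.I * ((conj (potential α k (rotatePair j k φ x)) * (-(v φ))).re : ℂ)
                * u (rotatePair j k φ x)) := by
          have : a φ = (conj (potential α j (rotatePair j k φ x)) * v φ).re
            + (conj (potential α k (rotatePair j k φ x)) * (-(v φ))).re := rfl
          rw [this, hV, map_add]
          push_cast
          ring
        have h7 : ‖v φ‖ₑ = ‖(x j - x k) / 2‖ₑ := by
          rw [← ofReal_norm, ← ofReal_norm]
          simp only [hv, norm_mul, Complex.norm_I, Complex.norm_exp_ofReal_mul_I, one_mul]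
        rw [h6, mul_add]
        refine (enorm_add_le _ _).trans (add_le_add ?_ ?_)
        · exact (enorm_covariant_le j _ (v φ)).trans_eq (by rw [h7])
        · exact (enorm_covariant_le k _ (-(v φ))).trans_eq (by rw [enorm_neg, h7])

theorem ae_norm_relative_ne (j k : Fin N) : ∀ᵐ x : Fin N → ℂ,
    ∀ l, l ≠ j → l ≠ k → ‖x l - (x j + x k) / 2‖ ≠ ‖(x j - x k) / 2‖ := by
  rw [ae_all_iff]
  intro l
  by_cases hlj : l = j
  · simp [hlj]
  by_cases hlk : l = k
  · simp [hlk]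
  have hm : MeasurableSet {x : Fin N → ℂ | ‖x l - (x j + x k) / 2‖ = ‖(x j - x k) / 2‖} :=
    measurableSet_eq_fun (by fun_prop) (by fun_prop)
  have h0 : volume {x : Fin N → ℂ | ‖x l - (x j + x k) / 2‖ = ‖(x j - x k) / 2‖} = 0 := by
    rw [← lintegral_indicator_one hm,
      lintegral_eq_lintegral_insertAt' l (measurable_one.indicator hm)]
    refine (lintegral_congr fun z => ?_).trans lintegral_zero
    have e : (fun y : ℂ => ({x : Fin N → ℂ | ‖x l - (x j + x k) / 2‖ =
        ‖(x j - x k) / 2‖}.indicator 1 (insertAt l y z) : ℝ≥0∞))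
        = (Metric.sphere ((z ⟨j, Ne.symm hlj⟩ + z ⟨k, Ne.symm hlk⟩) / 2)
          ‖(z ⟨j, Ne.symm hlj⟩ - z ⟨k, Ne.symm hlk⟩) / 2‖).indicator 1 := by
      funext y
      simp only [Set.indicator, Set.mem_ofPred_eq, Pi.one_apply, insertAt_self,
        insertAt_of_ne l y z (Ne.symm hlj), insertAt_of_ne l y z (Ne.symm hlk),
        mem_sphere_iff_norm]
    rw [e, lintegral_indicator_one Metric.isClosed_sphere.measurableSet]
    exact Measure.addHaar_sphere _ _ _
  filter_upwards [measure_eq_zero_iff_ae_notMem.1 h0] with x hx _ _ using hx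

theorem sq_setLIntegral_le {f : ℝ → ℝ≥0∞} (hf : Measurable f) (S : Set ℝ) :
    (∫⁻ t in S, f t) ^ 2 ≤ volume S * ∫⁻ t in S, f t ^ 2 := by
  have h := ENNReal.lintegral_mul_le_Lp_mul_Lq (volume.restrict S) Real.HolderConjugate.two_two
    (f := fun _ => 1) (g := f) aemeasurable_const hf.aemeasurable
  simp only [Pi.mul_apply, one_mul, lintegral_const,
    Measure.restrict_apply_univ, ENNReal.rpow_two] at h
  have e : ∀ t : ℝ≥0∞, (t ^ (1 / 2 : ℝ)) ^ 2 = t := fun t => by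
    rw [← ENNReal.rpow_natCast, ← ENNReal.rpow_mul]
    norm_num
  calc _ ≤ _ := pow_le_pow_left₀ (by simp) h 2
    _ = _ := by rw [mul_pow, e, e, one_pow, one_mul]

theorem weighted_pair_inequality (hu : IsAnyonWF N u) {j k : Fin N} (h : j ≠ k)
    {W : (Fin N → ℂ) → ℝ≥0∞} (hW : Measurable W)
    (hinv : ∀ φ x, W (rotatePair j k φ x) = W x) :
    ENNReal.ofReal (2 * statC α N) ^ 2 * ∫⁻ x, W x * ‖u x‖ₑ ^ 2 ≤
      ENNReal.ofReal Real.pi ^ 2 * ∫⁻ x, W x * (‖(x j - x k) / 2‖ₑ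
        * (covNorm α u j x + covNorm α u k x)) ^ 2 := by
  set F : (Fin N → ℂ) → ℝ≥0∞ := fun x => (‖(x j - x k) / 2‖ₑ
        * (covNorm α u j x + covNorm α u k x)) ^ 2 with hF
  have hFm : Measurable F := by
    have h1 := measurable_covNorm (α := α) hu.smooth j
    have h2 := measurable_covNorm (α := α) hu.smooth k
    exact (Measurable.mul (by fun_prop) (h1.add h2)).pow_const 2
  have hum : Measurable u := hu.smooth.continuous.measurable
  have hrm : Measurable fun p : (Fin N → ℂ) × ℝ => rotatePair j k p.2 p.1 :=
    ((continuous_rotatePair j k).comp continuous_swap).measurable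
  have hpt : ∀ᵐ x : Fin N → ℂ, ENNReal.ofReal (2 * statC α N) ^ 2 * (W x * ‖u x‖ₑ ^ 2) ≤
      ENNReal.ofReal Real.pi * ∫⁻ φ in Set.Icc 0 Real.pi,
        W (rotatePair j k φ x) * F (rotatePair j k φ x) := by
    filter_upwards [ae_norm_relative_ne j k] with x hx
    have h1 := pow_le_pow_left₀ (by simp) (pair_inequality (α := α) hu h hx) 2
    have hrm' : Measurable fun φ : ℝ => rotatePair j k φ x :=
      hrm.comp (measurable_const.prodMk measurable_id)
    have h2 := h1.trans (sq_setLIntegral_le (by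
      have h1 := (measurable_covNorm (α := α) hu.smooth j).comp hrm'
      have h2 := (measurable_covNorm (α := α) hu.smooth k).comp hrm'
      exact measurable_const.mul (h1.add h2)) _)
    rw [Real.volume_Icc, sub_zero, mul_pow] at h2
    have h3 : ∀ φ, ‖(x j - x k) / 2‖ₑ = ‖(rotatePair j k φ x j - rotatePair j k φ x k) / 2‖ₑ := by
      intro φ
      rw [rotatePair_sub_eq h, ← ofReal_norm, ← ofReal_norm]
      simp only [norm_mul, norm_div, Complex.norm_exp_ofReal_mul_I, one_mul]
    calc ENNReal.ofReal (2 * statC α N) ^ 2 * (W x * ‖u x‖ₑ ^ 2)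
        = W x * (ENNReal.ofReal (2 * statC α N) ^ 2 * ‖u x‖ₑ ^ 2) := by ring
      _ ≤ W x * (ENNReal.ofReal Real.pi * ∫⁻ φ in Set.Icc 0 Real.pi, (‖(x j - x k) / 2‖ₑ
          * (covNorm α u j (rotatePair j k φ x) + covNorm α u k (rotatePair j k φ x))) ^ 2) :=
        mul_le_mul_right h2 _
      _ = _ := by
        rw [mul_left_comm]
        congr 1
        rw [← lintegral_const_mul _ (by
          have h1 := (measurable_covNorm (α := α) hu.smooth j).comp hrm'
          have h2 := (measurable_covNorm (α := α) hu.smooth k).comp hrm'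
          exact (measurable_const.mul (h1.add h2)).pow_const 2)]
        refine lintegral_congr fun φ => ?_
        rw [hinv, hF, h3 φ]
  calc _ = ∫⁻ x, ENNReal.ofReal (2 * statC α N) ^ 2 * (W x * ‖u x‖ₑ ^ 2) :=
        (lintegral_const_mul _ (by fun_prop)).symm
    _ ≤ _ := lintegral_mono_ae hpt
    _ = ENNReal.ofReal Real.pi * ∫⁻ x, ∫⁻ φ in Set.Icc 0 Real.pi,
        W (rotatePair j k φ x) * F (rotatePair j k φ x) :=
        lintegral_const_mul _ (Measurable.lintegral_prod_right'
          (f := fun p : (Fin N → ℂ) × ℝ => W (rotatePair j k p.2 p.1)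
            * F (rotatePair j k p.2 p.1)) ((hW.comp hrm).mul (hFm.comp hrm)))
    _ = ENNReal.ofReal Real.pi * ∫⁻ φ in Set.Icc 0 Real.pi, ∫⁻ x,
        W (rotatePair j k φ x) * F (rotatePair j k φ x) := by
        rw [lintegral_lintegral_swap ((hW.comp hrm).mul (hFm.comp hrm)).aemeasurable]
    _ = ENNReal.ofReal Real.pi * ∫⁻ φ in Set.Icc 0 Real.pi, ∫⁻ x, W x * F x := by
        congr 1
        refine lintegral_congr fun φ => ?_
        exact (measurePreserving_rotatePair h φ).lintegral_comp (hW.mul hFm)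
    _ = _ := by
        rw [lintegral_const, Measure.restrict_apply_univ, Real.volume_Icc, sub_zero]
        ring

end Pair

section Exclusion

variable {N : ℕ} {α : ℝ} {u : (Fin N → ℂ) → ℂ}

/-- The number of particles of the configuration `x` lying in `S`. -/
def occupation (S : Set ℂ) (x : Fin N → ℂ) : ℝ≥0∞ := ∑ j, S.indicator 1 (x j)

theorem measurable_indicator_apply {S : Set ℂ} (hS : MeasurableSet S) (j : Fin N) :
    Measurable fun x : Fin N → ℂ => (S.indicator 1 (x j) : ℝ≥0∞) :=
  (measurable_one.indicator hS).comp (measurable_pi_apply j)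

theorem measurable_occupation {S : Set ℂ} (hS : MeasurableSet S) :
    Measurable (occupation S : (Fin N → ℂ) → ℝ≥0∞) :=
  Finset.measurable_fun_sum _ fun j _ => measurable_indicator_apply hS j

theorem occupation_ne_top (S : Set ℂ) (x : Fin N → ℂ) : occupation S x ≠ ⊤ := by
  refine (ENNReal.sum_lt_top.2 fun j _ => ?_).ne
  by_cases h : x j ∈ S <;> simp [h]

theorem setLIntegral_preimage_eq {S : Set ℂ} (hS : MeasurableSet S) (j : Fin N)
    (F : (Fin N → ℂ) → ℝ≥0∞) :
    ∫⁻ x in (fun x => x j) ⁻¹' S, F x = ∫⁻ x, S.indicator 1 (x j) * F x := by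
  rw [← lintegral_indicator (measurable_pi_apply j hS)]
  refine lintegral_congr fun x => ?_
  by_cases h : x j ∈ S <;> simp [Set.indicator, h]

theorem setLIntegral_edensity (hu : Measurable u) {S : Set ℂ} (hS : MeasurableSet S) :
    ∫⁻ y in S, edensity u y = ∫⁻ x, occupation S x * ‖u x‖ₑ ^ 2 := by
  have h := setLIntegral_marginal (F := fun (_ : Fin N) x => ‖u x‖ₑ ^ 2)
    (fun _ => by fun_prop) hS
  refine h.trans ?_
  simp_rw [setLIntegral_preimage_eq hS, occupation, Finset.sum_mul]
  exact (lintegral_finsetSum _ fun j _ =>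
    (measurable_indicator_apply hS j).mul (by fun_prop)).symm

theorem localEnergy_eq (hu : ContDiff ℝ (⊤ : ℕ∞) u) {S : Set ℂ} (hS : MeasurableSet S) :
    localEnergy α u S = ∫⁻ x, ∑ j, S.indicator 1 (x j) * covNorm α u j x ^ 2 := by
  unfold localEnergy
  simp_rw [setLIntegral_preimage_eq hS]
  exact (lintegral_finsetSum _ fun j _ => (measurable_indicator_apply hS j).mul
    ((measurable_covNorm hu j).pow_const 2)).symm

/-- The half-open square with lower left corner `a + b i` and side length `l`. -/
def square (a b l : ℝ) : Set ℂ := Set.Ico a (a + l) ×ℂ Set.Ico b (b + l)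

theorem measurableSet_square (a b l : ℝ) : MeasurableSet (square a b l) :=
  measurableSet_reProdIm measurableSet_Ico measurableSet_Ico

/-- The configurations for which the circle with diameter `x j`, `x k` stays in the square. -/
def circleIn (a b l : ℝ) (j k : Fin N) : Set (Fin N → ℂ) :=
  {x | a ≤ ((x j + x k) / 2).re - ‖(x j - x k) / 2‖ ∧
    ((x j + x k) / 2).re + ‖(x j - x k) / 2‖ < a + l ∧
    b ≤ ((x j + x k) / 2).im - ‖(x j - x k) / 2‖ ∧
    ((x j + x k) / 2).im + ‖(x j - x k) / 2‖ < b + l}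

theorem measurableSet_circleIn (a b l : ℝ) (j k : Fin N) :
    MeasurableSet (circleIn a b l j k) := by
  have h1 : Measurable fun x : Fin N → ℂ => ((x j + x k) / 2).re :=
    Complex.measurable_re.comp (by fun_prop)
  have h2 : Measurable fun x : Fin N → ℂ => ((x j + x k) / 2).im :=
    Complex.measurable_im.comp (by fun_prop)
  have h3 : Measurable fun x : Fin N → ℂ => ‖(x j - x k) / 2‖ := by fun_prop
  exact (measurableSet_le measurable_const (h1.sub h3)).inter
    ((measurableSet_lt (h1.add h3) measurable_const).inter
      ((measurableSet_le measurable_const (h2.sub h3)).inter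
        (measurableSet_lt (h2.add h3) measurable_const)))

theorem rotatePair_mem_circleIn_iff {a b l : ℝ} {j k : Fin N} (h : j ≠ k) (φ : ℝ)
    (x : Fin N → ℂ) : rotatePair j k φ x ∈ circleIn a b l j k ↔ x ∈ circleIn a b l j k := by
  have h1 : ‖(rotatePair j k φ x j - rotatePair j k φ x k) / 2‖ = ‖(x j - x k) / 2‖ := by
    rw [rotatePair_sub_eq h]
    simp only [norm_mul, norm_div, Complex.norm_exp_ofReal_mul_I, one_mul]
  simp only [circleIn, Set.mem_ofPred_eq, rotatePair_add_eq h, h1]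

theorem left_mem_square {a b l : ℝ} {j k : Fin N} {x : Fin N → ℂ}
    (hx : x ∈ circleIn a b l j k) : x j ∈ square a b l := by
  obtain ⟨h1, h2, h3, h4⟩ := hx
  have e : x j = (x j + x k) / 2 + (x j - x k) / 2 := by ring
  have hr := abs_le.1 (Complex.abs_re_le_norm ((x j - x k) / 2))
  have hi := abs_le.1 (Complex.abs_im_le_norm ((x j - x k) / 2))
  have er := congrArg Complex.re e
  have ei := congrArg Complex.im e
  rw [Complex.add_re] at er
  rw [Complex.add_im] at ei
  refine ⟨⟨?_, ?_⟩, ⟨?_, ?_⟩⟩ <;> linarith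

theorem circleIn_comm (a b l : ℝ) (j k : Fin N) : circleIn a b l j k = circleIn a b l k j := by
  ext x
  have : ‖(x j - x k) / 2‖ = ‖(x k - x j) / 2‖ := by rw [norm_div, norm_div, norm_sub_rev]
  simp only [circleIn, Set.mem_ofPred_eq, this, add_comm (x j)]

theorem right_mem_square {a b l : ℝ} {j k : Fin N} {x : Fin N → ℂ}
    (hx : x ∈ circleIn a b l j k) : x k ∈ square a b l :=
  left_mem_square (circleIn_comm a b l j k ▸ hx)

theorem occupation_rotatePair {a b l : ℝ} {j k : Fin N} (h : j ≠ k) (φ : ℝ) {x : Fin N → ℂ}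
    (hx : x ∈ circleIn a b l j k) :
    occupation (square a b l) (rotatePair j k φ x) = occupation (square a b l) x := by
  have hx' := (rotatePair_mem_circleIn_iff h φ x).2 hx
  refine Finset.sum_congr rfl fun i _ => ?_
  by_cases hj : i = j
  · subst hj
    rw [Set.indicator_of_mem (left_mem_square hx), Set.indicator_of_mem (left_mem_square hx')]
    rfl
  by_cases hk : i = k
  · subst hk
    rw [Set.indicator_of_mem (right_mem_square hx), Set.indicator_of_mem (right_mem_square hx')]
    rfl
  · rw [rotatePair_of_ne hj hk]

/-- The weight attached to the pair `j`, `k` in the local exclusion estimate. -/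
def pairWeight (a b l : ℝ) (j k : Fin N) : (Fin N → ℂ) → ℝ≥0∞ :=
  (circleIn a b l j k).indicator fun x => (occupation (square a b l) x)⁻¹

theorem measurable_pairWeight (a b l : ℝ) (j k : Fin N) : Measurable (pairWeight a b l j k) :=
  (measurable_occupation (measurableSet_square a b l)).inv.indicator
    (measurableSet_circleIn a b l j k)

theorem pairWeight_rotatePair {a b l : ℝ} {j k : Fin N} (h : j ≠ k) (φ : ℝ) (x : Fin N → ℂ) :
    pairWeight a b l j k (rotatePair j k φ x) = pairWeight a b l j k x := by
  by_cases hx : x ∈ circleIn a b l j k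
  · rw [pairWeight, Set.indicator_of_mem hx,
      Set.indicator_of_mem ((rotatePair_mem_circleIn_iff h φ x).2 hx),
      occupation_rotatePair h φ hx]
  · rw [pairWeight, Set.indicator_of_notMem hx,
      Set.indicator_of_notMem (mt (rotatePair_mem_circleIn_iff h φ x).1 hx)]

theorem pairWeight_mul_le (a b l : ℝ) (j k : Fin N) (x : Fin N → ℂ) (s t : ℝ≥0∞) :
    pairWeight a b l j k x * (‖(x j - x k) / 2‖ₑ * (s + t)) ^ 2 ≤
      2⁻¹ * ENNReal.ofReal l ^ 2 * ((occupation (square a b l) x)⁻¹ *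
        ((square a b l).indicator 1 (x j) * (square a b l).indicator 1 (x k) *
          (s ^ 2 + t ^ 2))) := by
  by_cases hx : x ∈ circleIn a b l j k
  · rw [pairWeight, Set.indicator_of_mem hx, Set.indicator_of_mem (left_mem_square hx),
      Set.indicator_of_mem (right_mem_square hx), Pi.one_apply, Pi.one_apply, one_mul, one_mul,
      mul_left_comm]
    refine mul_le_mul_right ?_ _
    have hr : ‖(x j - x k) / 2‖ₑ ≤ ENNReal.ofReal (l / 2) := by
      obtain ⟨h1, h2, -, -⟩ := hx
      rw [← ofReal_norm]
      exact ENNReal.ofReal_le_ofReal (by linarith)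
    rw [ENNReal.ofReal_div_of_pos two_pos, ENNReal.ofReal_ofNat] at hr
    have hst : (s + t) ^ 2 ≤ 2 * (s ^ 2 + t ^ 2) := by
      by_cases hs : s = ⊤
      · simp [hs]
      by_cases ht : t = ⊤
      · simp [ht]
      lift s to NNReal using hs
      lift t to NNReal using ht
      exact_mod_cast add_sq_le (a := s) (b := t)
    rw [mul_pow]
    refine (mul_le_mul' (pow_le_pow_left₀ (by simp) hr 2) hst).trans (le_of_eq ?_)
    have h2 : (2 : ℝ≥0∞)⁻¹ * 2 = 1 := ENNReal.inv_mul_cancel two_ne_zero (by simp)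
    rw [div_eq_mul_inv]
    calc _ = (2⁻¹ * 2) * (2⁻¹ * ENNReal.ofReal l ^ 2 * (s ^ 2 + t ^ 2)) := by ring
      _ = _ := by rw [h2, one_mul]
  · rw [pairWeight, Set.indicator_of_notMem hx, zero_mul]
    exact zero_le

theorem sum_pairWeight_mul_le (a b l : ℝ) (x : Fin N → ℂ) (d : Fin N → ℝ≥0∞) :
    ∑ j, ∑ k ∈ Finset.univ.erase j,
        pairWeight a b l j k x * (‖(x j - x k) / 2‖ₑ * (d j + d k)) ^ 2 ≤
      ENNReal.ofReal l ^ 2 * ∑ j, (square a b l).indicator 1 (x j) * d j ^ 2 := by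
  set n := occupation (square a b l) x with hn
  set e : Fin N → ℝ≥0∞ := fun j => (square a b l).indicator 1 (x j) with he
  have hne : n = ∑ j, e j := rfl
  calc _ ≤ ∑ j, ∑ k, 2⁻¹ * ENNReal.ofReal l ^ 2 * (n⁻¹ * (e j * e k * (d j ^ 2 + d k ^ 2))) :=
        Finset.sum_le_sum fun j _ =>
          (Finset.sum_le_sum fun k _ => pairWeight_mul_le a b l j k x (d j) (d k)).trans
            (Finset.sum_le_sum_of_subset (Finset.erase_subset _ _))
    _ = 2⁻¹ * ENNReal.ofReal l ^ 2 * (n⁻¹ * ∑ j, ∑ k, e j * e k * (d j ^ 2 + d k ^ 2)) := by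
        simp_rw [Finset.mul_sum]
    _ = 2⁻¹ * ENNReal.ofReal l ^ 2 * (n⁻¹ * (2 * (n * ∑ j, e j * d j ^ 2))) := by
        congr 2
        have h1 : ∑ j, ∑ k, e j * e k * d j ^ 2 = n * ∑ j, e j * d j ^ 2 := by
          rw [hne, Finset.sum_mul_sum, Finset.sum_comm]
          refine Finset.sum_congr rfl fun j _ => Finset.sum_congr rfl fun k _ => by ring
        have h2 : ∑ j, ∑ k, e j * e k * d k ^ 2 = n * ∑ j, e j * d j ^ 2 := by
          rw [hne, Finset.sum_mul_sum]
          refine Finset.sum_congr rfl fun j _ => Finset.sum_congr rfl fun k _ => by ring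
        simp_rw [mul_add, Finset.sum_add_distrib]
        rw [h1, h2, two_mul]
    _ = (2⁻¹ * 2) * (ENNReal.ofReal l ^ 2 * ((n⁻¹ * n) * ∑ j, e j * d j ^ 2)) := by ring
    _ ≤ 1 * (ENNReal.ofReal l ^ 2 * (1 * ∑ j, e j * d j ^ 2)) := by
        gcongr
        · exact ENNReal.inv_mul_le_one 2
        · exact ENNReal.inv_mul_le_one n
    _ = _ := by rw [one_mul, one_mul]

theorem mem_circleIn_of_mem_middle {a b l : ℝ} {j k : Fin N} {x : Fin N → ℂ}
    (hj : x j ∈ square (a + l / 3) (b + l / 3) (l / 3))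
    (hk : x k ∈ square (a + l / 3) (b + l / 3) (l / 3)) : x ∈ circleIn a b l j k := by
  obtain ⟨⟨h1, h2⟩, h3, h4⟩ := hj
  obtain ⟨⟨h5, h6⟩, h7, h8⟩ := hk
  have hr : ‖(x j - x k) / 2‖ < l / 3 := by
    rw [norm_div, Complex.norm_ofNat]
    have h := Complex.norm_le_abs_re_add_abs_im (x j - x k)
    rw [Complex.sub_re, Complex.sub_im] at h
    have h9 : |(x j).re - (x k).re| < l / 3 := abs_lt.2 ⟨by linarith, by linarith⟩
    have h10 : |(x j).im - (x k).im| < l / 3 := abs_lt.2 ⟨by linarith, by linarith⟩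
    linarith
  have er : ((x j + x k) / 2).re = ((x j).re + (x k).re) / 2 := by simp
  have ei : ((x j + x k) / 2).im = ((x j).im + (x k).im) / 2 := by simp
  refine ⟨?_, ?_, ?_, ?_⟩ <;> simp only [er, ei] <;> linarith

theorem occupation_mono {S T : Set ℂ} (h : S ⊆ T) (x : Fin N → ℂ) :
    occupation S x ≤ occupation T x :=
  Finset.sum_le_sum fun _ _ => Set.indicator_le_indicator_of_subset h (by simp) _

theorem square_middle_subset (a b l : ℝ) :
    square (a + l / 3) (b + l / 3) (l / 3) ⊆ square a b l := by
  rintro z ⟨⟨h1, h2⟩, h3, h4⟩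
  exact ⟨⟨by linarith, by linarith⟩, by linarith, by linarith⟩

theorem occupation_sq_le (a b l : ℝ) (x : Fin N → ℂ) :
    occupation (square (a + l / 3) (b + l / 3) (l / 3)) x ^ 2 ≤
      occupation (square a b l) x * ∑ j, ∑ k ∈ Finset.univ.erase j, pairWeight a b l j k x
        + occupation (square (a + l / 3) (b + l / 3) (l / 3)) x := by
  set K := square (a + l / 3) (b + l / 3) (l / 3) with hK
  set n := occupation (square a b l) x with hn
  set e : Fin N → ℝ≥0∞ := fun j => K.indicator 1 (x j) with he
  have hpair : ∀ j k, e j * e k ≤ n * pairWeight a b l j k x := by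
    intro j k
    by_cases hj : x j ∈ K
    · by_cases hk : x k ∈ K
      · have hc := mem_circleIn_of_mem_middle hj hk
        have hn0 : n ≠ 0 := by
          have h1 : (square a b l).indicator 1 (x j) ≤ n :=
            Finset.single_le_sum (f := fun i => ((square a b l).indicator 1 (x i) : ℝ≥0∞))
              (fun _ _ => zero_le) (Finset.mem_univ j)
          rw [Set.indicator_of_mem (square_middle_subset a b l hj)] at h1
          exact (lt_of_lt_of_le one_pos h1).ne'
        rw [pairWeight, Set.indicator_of_mem hc,
          ENNReal.mul_inv_cancel hn0 (occupation_ne_top _ _)]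
        simp [he, hj, hk]
      · simp [he, hk]
    · simp [he, hj]
  have hself : ∀ j, e j * e j = e j := by
    intro j
    by_cases hj : x j ∈ K <;> simp [he, hj]
  calc occupation K x ^ 2 = ∑ j, (∑ k ∈ Finset.univ.erase j, e j * e k + e j) := by
        change (∑ j, e j) ^ 2 = _
        rw [sq, Finset.sum_mul_sum]
        refine Finset.sum_congr rfl fun j _ => ?_
        rw [← Finset.sum_erase_add _ _ (Finset.mem_univ j), hself]
    _ = (∑ j, ∑ k ∈ Finset.univ.erase j, e j * e k) + occupation K x :=
        Finset.sum_add_distrib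
    _ ≤ (∑ j, ∑ k ∈ Finset.univ.erase j, n * pairWeight a b l j k x) + occupation K x := by
        refine add_le_add_left (Finset.sum_le_sum fun j _ => Finset.sum_le_sum fun k _ => ?_) _
        exact hpair j k
    _ = _ := by simp_rw [Finset.mul_sum]

theorem linear_le_of_sq_le {m n S : ℝ≥0∞} (hm : m ≠ ⊤) (hn : n ≠ ⊤) (hmn : m ≤ n)
    (h : m ^ 2 ≤ n * S + m) : 36 * m ≤ n + 324 * (1 + S) := by
  by_cases hS : S = ⊤
  · simp [hS]
  lift m to NNReal using hm
  lift n to NNReal using hn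
  lift S to NNReal using hS
  norm_cast at h hmn ⊢
  rw [← NNReal.coe_le_coe] at h hmn ⊢
  push_cast at h ⊢
  have hm0 := m.coe_nonneg
  have hS0 := S.coe_nonneg
  rcases eq_or_lt_of_le n.coe_nonneg with h0 | h0
  · nlinarith
  · refine le_of_mul_le_mul_left ?_ h0
    nlinarith [sq_nonneg ((n : ℝ) - 18 * m)]

theorem exclusion_inequality (hu : IsAnyonWF N u) (hnorm : ∫⁻ x, ‖u x‖ₑ ^ 2 = 1)
    (a b l : ℝ) :
    ENNReal.ofReal (statC α N) ^ 2 *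
        (36 * ∫⁻ y in square (a + l / 3) (b + l / 3) (l / 3), edensity u y) ≤
      ENNReal.ofReal (statC α N) ^ 2 * ((∫⁻ y in square a b l, edensity u y) + 324)
        + 972 * (ENNReal.ofReal l ^ 2 * localEnergy α u (square a b l)) := by
  have hum : Measurable u := hu.smooth.continuous.measurable
  set K := square (a + l / 3) (b + l / 3) (l / 3) with hK
  have hKm : MeasurableSet K := measurableSet_square _ _ _
  have hQm := measurableSet_square a b l
  set S : (Fin N → ℂ) → ℝ≥0∞ := fun x =>
    ∑ j, ∑ k ∈ Finset.univ.erase j, pairWeight a b l j k x with hS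
  have hSm : Measurable S := Finset.measurable_fun_sum _ fun j _ =>
    Finset.measurable_fun_sum _ fun k _ => measurable_pairWeight a b l j k
  have h1 : 36 * ∫⁻ y in K, edensity u y ≤
      (∫⁻ y in square a b l, edensity u y) + 324 * (1 + ∫⁻ x, S x * ‖u x‖ₑ ^ 2) := by
    have hK' := measurable_occupation (N := N) hKm
    have hQ' := measurable_occupation (N := N) hQm
    rw [setLIntegral_edensity hum hKm, setLIntegral_edensity hum hQm, ← hnorm,
      ← lintegral_add_left (by fun_prop), ← lintegral_const_mul _ (by fun_prop),
      ← lintegral_const_mul _ (by fun_prop), ← lintegral_add_left (by fun_prop)]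
    refine lintegral_mono fun x => ?_
    have := linear_le_of_sq_le (occupation_ne_top K x) (occupation_ne_top (square a b l) x)
      (occupation_mono (square_middle_subset a b l) x) (occupation_sq_le a b l x)
    calc 36 * (occupation K x * ‖u x‖ₑ ^ 2) = 36 * occupation K x * ‖u x‖ₑ ^ 2 := by ring
      _ ≤ (occupation (square a b l) x + 324 * (1 + S x)) * ‖u x‖ₑ ^ 2 := by gcongr
      _ = _ := by ring
  have h2 : ENNReal.ofReal (statC α N) ^ 2 * ∫⁻ x, S x * ‖u x‖ₑ ^ 2 ≤
      3 * (ENNReal.ofReal l ^ 2 * localEnergy α u (square a b l)) := by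
    have hpi : ENNReal.ofReal Real.pi ^ 2 ≤ 4 * 3 := by
      rw [← ENNReal.ofReal_pow Real.pi_pos.le]
      have : (4 * 3 : ℝ≥0∞) = ENNReal.ofReal 12 := by
        rw [ENNReal.ofReal_ofNat]; norm_num
      rw [this]
      apply ENNReal.ofReal_le_ofReal
      nlinarith [Real.pi_lt_d2, Real.pi_pos]
    have h3 : ENNReal.ofReal (2 * statC α N) ^ 2 * ∫⁻ x, S x * ‖u x‖ₑ ^ 2 ≤
        ENNReal.ofReal Real.pi ^ 2 * ∫⁻ x, ∑ j, ∑ k ∈ Finset.univ.erase j,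
          pairWeight a b l j k x *
            (‖(x j - x k) / 2‖ₑ * (covNorm α u j x + covNorm α u k x)) ^ 2 := by
      have hm1 : ∀ j k : Fin N, Measurable fun x => pairWeight a b l j k x * ‖u x‖ₑ ^ 2 :=
        fun j k => (measurable_pairWeight a b l j k).mul (by fun_prop)
      have hm2 : ∀ j k : Fin N, Measurable fun x => pairWeight a b l j k x *
          (‖(x j - x k) / 2‖ₑ * (covNorm α u j x + covNorm α u k x)) ^ 2 := by
        intro j k
        have h1 := measurable_covNorm (α := α) hu.smooth j
        have h2 := measurable_covNorm (α := α) hu.smooth k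
        exact (measurable_pairWeight a b l j k).mul
          ((Measurable.mul (by fun_prop) (h1.add h2)).pow_const 2)
      simp_rw [hS, Finset.sum_mul]
      rw [lintegral_finsetSum _ fun j _ => Finset.measurable_fun_sum _ fun k _ => hm1 j k,
        lintegral_finsetSum _ fun j _ => Finset.measurable_fun_sum _ fun k _ => hm2 j k,
        Finset.mul_sum, Finset.mul_sum]
      refine Finset.sum_le_sum fun j _ => ?_
      rw [lintegral_finsetSum _ fun k _ => hm1 j k, lintegral_finsetSum _ fun k _ => hm2 j k,
        Finset.mul_sum, Finset.mul_sum]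
      refine Finset.sum_le_sum fun k hk => ?_
      have hjk := (Finset.ne_of_mem_erase hk).symm
      exact weighted_pair_inequality hu hjk (measurable_pairWeight a b l j k)
        (pairWeight_rotatePair hjk)
    have h4 : ENNReal.ofReal (2 * statC α N) ^ 2 * ∫⁻ x, S x * ‖u x‖ₑ ^ 2 ≤
        (4 * 3) * (ENNReal.ofReal l ^ 2 * localEnergy α u (square a b l)) := by
      refine h3.trans (mul_le_mul' hpi ?_)
      have hm : Measurable fun x : Fin N → ℂ =>
          ∑ j, (square a b l).indicator 1 (x j) * covNorm α u j x ^ 2 :=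
        Finset.measurable_fun_sum _ fun j _ => (measurable_indicator_apply hQm j).mul
          ((measurable_covNorm hu.smooth j).pow_const 2)
      rw [localEnergy_eq hu.smooth hQm, ← lintegral_const_mul _ hm]
      exact lintegral_mono fun x => sum_pairWeight_mul_le a b l x fun j => covNorm α u j x
    rw [ENNReal.ofReal_mul zero_le_two, ENNReal.ofReal_ofNat, mul_pow, mul_assoc,
      mul_assoc 4] at h4
    have h5 : (2 : ℝ≥0∞) ^ 2 = 4 := by norm_num
    rw [h5] at h4
    exact (ENNReal.mul_le_mul_iff_right (by norm_num) (by simp)).1 h4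
  calc _ ≤ ENNReal.ofReal (statC α N) ^ 2 * ((∫⁻ y in square a b l, edensity u y)
        + 324 * (1 + ∫⁻ x, S x * ‖u x‖ₑ ^ 2)) := by gcongr
    _ = ENNReal.ofReal (statC α N) ^ 2 * ((∫⁻ y in square a b l, edensity u y) + 324)
        + 324 * (ENNReal.ofReal (statC α N) ^ 2 * ∫⁻ x, S x * ‖u x‖ₑ ^ 2) := by ring
    _ ≤ ENNReal.ofReal (statC α N) ^ 2 * ((∫⁻ y in square a b l, edensity u y) + 324)
        + 324 * (3 * (ENNReal.ofReal l ^ 2 * localEnergy α u (square a b l))) := by gcongr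
    _ = _ := by ring

end Exclusion

section RealInequalities

theorem sq_le_four_mul_of_forall_le {G M T : ℝ} (hG : 0 ≤ G) (hM : 0 ≤ M) (hT : 0 ≤ T)
    (h : ∀ s : ℝ, 0 < s → G ≤ s * M + s⁻¹ * T) : G ^ 2 ≤ 4 * M * T := by
  have hq : ∀ s : ℝ, 0 ≤ M * (s * s) + -G * s + T := by
    intro s
    rcases le_or_gt s 0 with hs | hs
    · nlinarith [mul_self_nonneg s, mul_nonneg hM (mul_self_nonneg s)]
    · have h1 := mul_le_mul_of_nonneg_left (h s hs) hs.le
      have h2 : s * (s * M + s⁻¹ * T) = M * (s * s) + T := by field_simp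
      linarith
  have := discrim_le_zero hq
  rw [discrim] at this
  nlinarith

theorem energy_lower_bound_of_heavy {c M K G T l : ℝ} (hc0 : 0 ≤ c) (hc1 : c ≤ 1)
    (hl : 0 < l) (hGMT : G ^ 2 ≤ 4 * M * T)
    (hstrip : M ≤ 9 * K + 4 * (l * G))
    (hexcl : c * (36 * K) ≤ c * (M + 324) + 972 * (l ^ 2 * T)) (hM : 648 ≤ M) :
    c ≤ 3 * (l ^ 2 * T) := by
  rcases le_or_gt M (18 * K) with h | h
  · nlinarith
  · have h1 : M ≤ 8 * (l * G) := by linarith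
    have h2 : M ^ 2 ≤ 64 * (l ^ 2 * G ^ 2) := by nlinarith
    have h3 : l ^ 2 * G ^ 2 ≤ l ^ 2 * (4 * M * T) := by gcongr
    have h4 : M ≤ 256 * (l ^ 2 * T) := by
      refine le_of_mul_le_mul_left ?_ (by linarith : 0 < M)
      nlinarith
    nlinarith

theorem mul_sq_le_of_uncertainty {c M G T R l : ℝ} (hc0 : 0 ≤ c) (hc1 : c ≤ 1)
    (hM0 : 0 ≤ M) (hT : 0 ≤ T) (hl : 0 < l) (hGMT : G ^ 2 ≤ 4 * M * T)
    (hR : l ^ 2 * R ≤ (M + l * G) ^ 2) {L : ℝ} (hM : M ≤ L) :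
    c * R ≤ 8 * L * T + 2 * L ^ 2 * (c / l ^ 2) := by
  have h1 : l ^ 2 * R ≤ 2 * M ^ 2 + 8 * (l ^ 2 * (M * T)) := by
    nlinarith [sq_nonneg (M - l * G), mul_le_mul_of_nonneg_left hGMT (sq_nonneg l)]
  have h2 : l ^ 2 * R ≤ 2 * L ^ 2 + 8 * (l ^ 2 * (L * T)) := by
    refine h1.trans ?_
    gcongr
  have h3 : c * (l ^ 2 * R) ≤ l ^ 2 * (8 * L * T + 2 * L ^ 2 * (c / l ^ 2)) := by
    have e : l ^ 2 * (8 * L * T + 2 * L ^ 2 * (c / l ^ 2))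
        = 8 * (l ^ 2 * (L * T)) + c * (2 * L ^ 2) := by
      field_simp
    rw [e]
    have h4 : 0 ≤ l ^ 2 * (L * T) := by
      have : 0 ≤ L := hM0.trans hM
      positivity
    nlinarith [mul_le_mul_of_nonneg_left h2 hc0]
  refine le_of_mul_le_mul_left ?_ (by positivity : 0 < l ^ 2)
  linarith

theorem dyadic_induction {M T R : ℝ → ℝ → ℝ → ℝ} {c B : ℝ}
    (hc : 0 ≤ c) (hT : ∀ a b l, 0 ≤ T a b l)
    (hMB : ∀ a b l, 0 < l → M a b l ≤ B * l ^ 2)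
    (hMadd : ∀ a b l, 0 < l → M a b l = M a b (l / 2) + M (a + l / 2) b (l / 2)
      + M a (b + l / 2) (l / 2) + M (a + l / 2) (b + l / 2) (l / 2))
    (hTadd : ∀ a b l, 0 < l → T a b l = T a b (l / 2) + T (a + l / 2) b (l / 2)
      + T a (b + l / 2) (l / 2) + T (a + l / 2) (b + l / 2) (l / 2))
    (hRadd : ∀ a b l, 0 < l → R a b l = R a b (l / 2) + R (a + l / 2) b (l / 2)
      + R a (b + l / 2) (l / 2) + R (a + l / 2) (b + l / 2) (l / 2))
    (hlight : ∀ a b l, 0 < l → M a b l ≤ 2592 →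
      c * R a b l ≤ 8 * 2592 * T a b l + 2 * 2592 ^ 2 * (c / l ^ 2))
    (hheavy : ∀ a b l, 0 < l → 648 ≤ M a b l → c ≤ 3 * (l ^ 2 * T a b l)) (n : ℕ) :
    ∀ a b l, 0 < l → B * l ^ 2 ≤ 2592 * 4 ^ n → 648 ≤ M a b l →
      c * R a b l + 8 * 2592 ^ 2 * (c / l ^ 2) ≤ (8 * 2592 + 30 * 2592 ^ 2) * T a b l := by
  have hbase : ∀ a b l, 0 < l → M a b l ≤ 2592 → 648 ≤ M a b l →
      c * R a b l + 8 * 2592 ^ 2 * (c / l ^ 2) ≤ (8 * 2592 + 30 * 2592 ^ 2) * T a b l := by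
    intro a b l hl h1 h2
    have h3 := hlight a b l hl h1
    have h4 : c / l ^ 2 ≤ 3 * T a b l := by
      rw [div_le_iff₀ (by positivity)]
      linarith [hheavy a b l hl h2]
    linarith
  induction n with
  | zero =>
    intro a b l hl hB h
    exact hbase a b l hl (by linarith [hMB a b l hl]) h
  | succ n ih =>
    intro a b l hl hB h
    rcases le_or_gt (M a b l) 2592 with hM | hM
    · exact hbase a b l hl hM h
    have hl2 : 0 < l / 2 := by positivity
    have hD : c / (l / 2) ^ 2 = 4 * (c / l ^ 2) := by field_simp; norm_num
    have hD0 : 0 ≤ c / l ^ 2 := by positivity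
    have hB' : B * (l / 2) ^ 2 ≤ 2592 * 4 ^ n := by
      rw [pow_succ (4 : ℝ) n] at hB
      linarith
    have hchild : ∀ a b, c * R a b (l / 2) ≤ (8 * 2592 + 30 * 2592 ^ 2) * T a b (l / 2)
          + 8 * 2592 ^ 2 * (c / l ^ 2)
        ∧ (648 ≤ M a b (l / 2) → c * R a b (l / 2) + 32 * 2592 ^ 2 * (c / l ^ 2)
          ≤ (8 * 2592 + 30 * 2592 ^ 2) * T a b (l / 2)) := by
      intro a b
      have h2 : 648 ≤ M a b (l / 2) → c * R a b (l / 2) + 32 * 2592 ^ 2 * (c / l ^ 2)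
          ≤ (8 * 2592 + 30 * 2592 ^ 2) * T a b (l / 2) := by
        intro h3
        have := ih a b (l / 2) hl2 hB' h3
        rw [hD] at this
        linarith
      refine ⟨?_, h2⟩
      rcases le_or_gt 648 (M a b (l / 2)) with h3 | h3
      · linarith [h2 h3]
      · have := hlight a b (l / 2) hl2 (by linarith)
        rw [hD] at this
        linarith [hT a b (l / 2)]
    rw [hRadd a b l hl, hTadd a b l hl]
    rw [hMadd a b l hl] at hM
    obtain ⟨p1, q1⟩ := hchild a b
    obtain ⟨p2, q2⟩ := hchild (a + l / 2) b
    obtain ⟨p3, q3⟩ := hchild a (b + l / 2)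
    obtain ⟨p4, q4⟩ := hchild (a + l / 2) (b + l / 2)
    by_cases m1 : 648 ≤ M a b (l / 2)
    · linarith [q1 m1]
    by_cases m2 : 648 ≤ M (a + l / 2) b (l / 2)
    · linarith [q2 m2]
    by_cases m3 : 648 ≤ M a (b + l / 2) (l / 2)
    · linarith [q3 m3]
    have m4 : 648 ≤ M (a + l / 2) (b + l / 2) (l / 2) := by linarith
    linarith [q4 m4]

theorem dyadic_bound {M T R : ℝ → ℝ → ℝ → ℝ} {c B : ℝ}
    (hc : 0 ≤ c) (hT : ∀ a b l, 0 ≤ T a b l)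
    (hMB : ∀ a b l, 0 < l → M a b l ≤ B * l ^ 2)
    (hMadd : ∀ a b l, 0 < l → M a b l = M a b (l / 2) + M (a + l / 2) b (l / 2)
      + M a (b + l / 2) (l / 2) + M (a + l / 2) (b + l / 2) (l / 2))
    (hTadd : ∀ a b l, 0 < l → T a b l = T a b (l / 2) + T (a + l / 2) b (l / 2)
      + T a (b + l / 2) (l / 2) + T (a + l / 2) (b + l / 2) (l / 2))
    (hRadd : ∀ a b l, 0 < l → R a b l = R a b (l / 2) + R (a + l / 2) b (l / 2)
      + R a (b + l / 2) (l / 2) + R (a + l / 2) (b + l / 2) (l / 2))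
    (hlight : ∀ a b l, 0 < l → M a b l ≤ 2592 →
      c * R a b l ≤ 8 * 2592 * T a b l + 2 * 2592 ^ 2 * (c / l ^ 2))
    (hheavy : ∀ a b l, 0 < l → 648 ≤ M a b l → c ≤ 3 * (l ^ 2 * T a b l))
    (a b l : ℝ) (hl : 0 < l) :
    c * R a b l ≤ (8 * 2592 + 30 * 2592 ^ 2) * T a b l + 2 * 2592 ^ 2 * (c / l ^ 2) := by
  have hD0 : 0 ≤ c / l ^ 2 := by positivity
  rcases le_or_gt 648 (M a b l) with h | h
  · obtain ⟨n, hn⟩ := pow_unbounded_of_one_lt (B * l ^ 2) (by norm_num : (1 : ℝ) < 4)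
    have h4 : (0 : ℝ) < 4 ^ n := by positivity
    have := dyadic_induction hc hT hMB hMadd hTadd hRadd hlight hheavy n a b l hl
      (by linarith) h
    linarith
  · linarith [hlight a b l hl (by linarith), hT a b l]

end RealInequalities

section Squares

variable {N : ℕ} {α : ℝ} {u : (Fin N → ℂ) → ℂ}

theorem setLIntegral_square_split (f : ℂ → ℝ≥0∞) (a b : ℝ) {l : ℝ} (hl : 0 < l) :
    ∫⁻ y in square a b l, f y = (∫⁻ y in square a b (l / 2), f y)
      + (∫⁻ y in square (a + l / 2) b (l / 2), f y)
      + (∫⁻ y in square a (b + l / 2) (l / 2), f y)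
      + ∫⁻ y in square (a + l / 2) (b + l / 2) (l / 2), f y := by
  have e : square a b l = square a b (l / 2) ∪ square (a + l / 2) b (l / 2)
      ∪ square a (b + l / 2) (l / 2) ∪ square (a + l / 2) (b + l / 2) (l / 2) := by
    ext z
    simp only [square, Set.mem_union, Complex.mem_reProdIm, Set.mem_Ico]
    constructor
    · rintro ⟨⟨h1, h2⟩, h3, h4⟩
      rcases lt_or_ge z.re (a + l / 2) with h5 | h5 <;>
        rcases lt_or_ge z.im (b + l / 2) with h6 | h6
      · exact Or.inl (Or.inl (Or.inl ⟨⟨h1, h5⟩, h3, h6⟩))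
      · exact Or.inl (Or.inr ⟨⟨h1, h5⟩, h6, by linarith⟩)
      · exact Or.inl (Or.inl (Or.inr ⟨⟨h5, by linarith⟩, h3, h6⟩))
      · exact Or.inr ⟨⟨h5, by linarith⟩, h6, by linarith⟩
    · rintro (((⟨⟨h1, h2⟩, h3, h4⟩ | ⟨⟨h1, h2⟩, h3, h4⟩) | ⟨⟨h1, h2⟩, h3, h4⟩)
        | ⟨⟨h1, h2⟩, h3, h4⟩) <;>
        exact ⟨⟨by linarith, by linarith⟩, by linarith, by linarith⟩
  have d1 : Disjoint (square a b (l / 2)) (square (a + l / 2) b (l / 2)) := by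
    rw [Set.disjoint_left]
    rintro z ⟨⟨h1, h2⟩, h3, h4⟩ ⟨⟨h5, h6⟩, h7, h8⟩
    linarith
  have d2 : Disjoint (square a b (l / 2) ∪ square (a + l / 2) b (l / 2))
      (square a (b + l / 2) (l / 2)) := by
    rw [Set.disjoint_left]
    rintro z (⟨⟨h1, h2⟩, h3, h4⟩ | ⟨⟨h1, h2⟩, h3, h4⟩) ⟨⟨h5, h6⟩, h7, h8⟩ <;> linarith
  have d3 : Disjoint (square a b (l / 2) ∪ square (a + l / 2) b (l / 2)
      ∪ square a (b + l / 2) (l / 2)) (square (a + l / 2) (b + l / 2) (l / 2)) := by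
    rw [Set.disjoint_left]
    rintro z ((⟨⟨h1, h2⟩, h3, h4⟩ | ⟨⟨h1, h2⟩, h3, h4⟩) | ⟨⟨h1, h2⟩, h3, h4⟩)
      ⟨⟨h5, h6⟩, h7, h8⟩ <;> linarith
  rw [e, lintegral_union (measurableSet_square _ _ _) d3,
    lintegral_union (measurableSet_square _ _ _) d2,
    lintegral_union (measurableSet_square _ _ _) d1]

theorem toReal_setLIntegral_square_split {f : ℂ → ℝ≥0∞}
    (hf : ∀ a b l, ∫⁻ y in square a b l, f y ≠ ⊤) (a b : ℝ) {l : ℝ} (hl : 0 < l) :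
    (∫⁻ y in square a b l, f y).toReal = (∫⁻ y in square a b (l / 2), f y).toReal
      + (∫⁻ y in square (a + l / 2) b (l / 2), f y).toReal
      + (∫⁻ y in square a (b + l / 2) (l / 2), f y).toReal
      + (∫⁻ y in square (a + l / 2) (b + l / 2) (l / 2), f y).toReal := by
  rw [setLIntegral_square_split f a b hl, ENNReal.toReal_add (by simp [hf]) (hf _ _ _),
    ENNReal.toReal_add (by simp [hf]) (hf _ _ _), ENNReal.toReal_add (hf _ _ _) (hf _ _ _)]

theorem volume_square (a b : ℝ) {l : ℝ} (hl : 0 ≤ l) :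
    volume (square a b l) = ENNReal.ofReal (l ^ 2) := by
  have h := setLIntegral_reProdIm (f := fun _ => 1) measurable_const
    (A := Set.Ico a (a + l)) (B := Set.Ico b (b + l))
  simp only [setLIntegral_one, setLIntegral_const, Real.volume_Ico, add_sub_cancel_left] at h
  rw [square, h, sq, ENNReal.ofReal_mul hl]

/-- The one-particle energy density. -/
def energyDensity (α : ℝ) (u : (Fin N → ℂ) → ℂ) : ℂ → ℝ≥0∞ :=
  marginal fun j x => covNorm α u j x ^ 2

theorem setLIntegral_energyDensity (hu : ContDiff ℝ (⊤ : ℕ∞) u) {S : Set ℂ}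
    (hS : MeasurableSet S) : ∫⁻ y in S, energyDensity α u y = localEnergy α u S :=
  setLIntegral_marginal (fun j => (measurable_covNorm hu j).pow_const 2) hS

theorem mass_le_middle (hu : ContDiff ℝ (⊤ : ℕ∞) u) (a b : ℝ) {l : ℝ} (hl : 0 < l) :
    ∫⁻ y in square a b l, edensity u y ≤
      9 * (∫⁻ y in square (a + l / 3) (b + l / 3) (l / 3), edensity u y)
        + 4 * (ENNReal.ofReal l * ∫⁻ y in square a b l, gradBound α u y) := by
  have h1 := mass_le_re_strip (α := α) hu (a := a) (b := a + l) (a' := a + l / 3)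
    (b' := a + l / 3 + l / 3) (by linarith) (by linarith) (Set.Ico b (b + l))
  have h2 := mass_le_im_strip (α := α) hu (a := b) (b := b + l) (a' := b + l / 3)
    (b' := b + l / 3 + l / 3) (by linarith) (by linarith)
    (Set.Ico (a + l / 3) (a + l / 3 + l / 3))
  have h3 : ∫⁻ z in Set.Ico (a + l / 3) (a + l / 3 + l / 3) ×ℂ Set.Ico b (b + l),
      gradBound α u z ≤ ∫⁻ z in square a b l, gradBound α u z := by
    refine lintegral_mono_set ?_
    rintro z ⟨⟨h1, h2⟩, h3⟩
    exact ⟨⟨by linarith, by linarith⟩, h3⟩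
  have e3 : ENNReal.ofReal l = 3 * ENNReal.ofReal (l / 3) := by
    rw [← ENNReal.ofReal_ofNat, ← ENNReal.ofReal_mul (by norm_num)]
    congr 1
    ring
  have e0 : ENNReal.ofReal (l / 3) ≠ 0 := by
    rw [Ne, ENNReal.ofReal_eq_zero]
    linarith
  have et : ENNReal.ofReal (l / 3) ≠ ⊤ := ENNReal.ofReal_ne_top
  simp only [add_sub_cancel_left] at h1 h2
  rw [e3]
  rw [e3] at h1 h2
  set t := ENNReal.ofReal (l / 3)
  have h1' : ∫⁻ y in square a b l, edensity u y ≤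
      3 * (∫⁻ z in Set.Ico (a + l / 3) (a + l / 3 + l / 3) ×ℂ Set.Ico b (b + l), edensity u z)
        + 3 * (t * ∫⁻ y in square a b l, gradBound α u y) := by
    refine (ENNReal.mul_le_mul_iff_right e0 et).1 (h1.trans (le_of_eq ?_))
    rw [square]
    ring
  have h2' : ∫⁻ z in Set.Ico (a + l / 3) (a + l / 3 + l / 3) ×ℂ Set.Ico b (b + l), edensity u z ≤
      3 * (∫⁻ y in square (a + l / 3) (b + l / 3) (l / 3), edensity u y)
        + 3 * (t * ∫⁻ z in Set.Ico (a + l / 3) (a + l / 3 + l / 3) ×ℂ Set.Ico b (b + l),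
          gradBound α u z) := by
    refine (ENNReal.mul_le_mul_iff_right e0 et).1 (h2.trans (le_of_eq ?_))
    rw [square]
    ring
  calc _ ≤ _ := h1'
    _ ≤ 3 * (3 * (∫⁻ y in square (a + l / 3) (b + l / 3) (l / 3), edensity u y)
        + 3 * (t * ∫⁻ y in square a b l, gradBound α u y))
        + 3 * (t * ∫⁻ y in square a b l, gradBound α u y) := by
      gcongr
      exact h2'.trans (by gcongr)
    _ = _ := by ring

end Squares

section Density

variable {N : ℕ} {α : ℝ} {u : (Fin N → ℂ) → ℂ}

theorem norm_insertAt_ge (j : Fin N) (y : ℂ) (z : {k : Fin N // k ≠ j} → ℂ) :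
    ‖y‖ ≤ ‖insertAt j y z‖ ∧ ‖z‖ ≤ ‖insertAt j y z‖ := by
  constructor
  · conv_lhs => rw [← insertAt_self j y z]
    exact norm_le_pi_norm _ j
  · refine (pi_norm_le_iff_of_nonneg (norm_nonneg _)).2 fun k => ?_
    have := norm_le_pi_norm (insertAt j y z) k
    rwa [insertAt_of_ne j y z k.2] at this

theorem exists_norm_le_of_ne_zero (hu : HasCompactSupport u) :
    ∃ r : ℝ, ∀ x, u x ≠ 0 → ‖x‖ ≤ r := by
  obtain ⟨r, hr⟩ := hu.isCompact.isBounded.exists_norm_le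
  exact ⟨r, fun x hx => hr x (subset_tsupport u hx)⟩

theorem exists_edensity_eq_zero (hu : HasCompactSupport u) :
    ∃ r : ℝ, ∀ y, r < ‖y‖ → edensity u y = 0 := by
  obtain ⟨r, hr⟩ := exists_norm_le_of_ne_zero hu
  refine ⟨r, fun y hy => ?_⟩
  rw [edensity]
  refine Finset.sum_eq_zero fun j _ => ?_
  refine (lintegral_congr fun z => ?_).trans lintegral_zero
  by_contra h
  have h0 : u (insertAt j y z) ≠ 0 := fun h0 => h (by simp [h0])
  linarith [hr _ h0, (norm_insertAt_ge j y z).1]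

theorem exists_edensity_le (hu : IsAnyonWF N u) : ∃ B : ℝ, 0 ≤ B ∧
    ∀ y, edensity u y ≤ ENNReal.ofReal B := by
  obtain ⟨r, hr⟩ := exists_norm_le_of_ne_zero hu.compactSupport
  obtain ⟨D, hD⟩ := hu.compactSupport.exists_bound_of_continuous hu.smooth.continuous
  set B : ℝ≥0∞ := ∑ j : Fin N, ENNReal.ofReal D ^ 2 *
    volume (Metric.closedBall (0 : {k : Fin N // k ≠ j} → ℂ) r) with hB
  have hBt : B ≠ ⊤ := by
    refine (ENNReal.sum_lt_top.2 fun j _ => ?_).ne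
    exact ENNReal.mul_lt_top (by simp) measure_closedBall_lt_top
  refine ⟨B.toReal, ENNReal.toReal_nonneg, fun y => ?_⟩
  rw [ENNReal.ofReal_toReal hBt, edensity, hB]
  refine Finset.sum_le_sum fun j _ => ?_
  rw [← setLIntegral_const, ← lintegral_indicator Metric.isClosed_closedBall.measurableSet]
  refine lintegral_mono fun z => ?_
  by_cases h0 : u (insertAt j y z) = 0
  · simp [h0]
  · rw [Set.indicator_of_mem (by
      simpa using (norm_insertAt_ge j y z).2.trans (hr _ h0))]
    refine pow_le_pow_left' ?_ 2
    rw [← ofReal_norm]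
    exact ENNReal.ofReal_le_ofReal (hD _)

theorem ofReal_density_sq (hu : IsAnyonWF N u) (y : ℂ) :
    ENNReal.ofReal (density N u y ^ 2) = edensity u y ^ 2 := by
  have h0 : ∀ j : Fin N, 0 ≤ ∫ z : {k : Fin N // k ≠ j} → ℂ, ‖u (insertAt j y z)‖ ^ 2 :=
    fun j => integral_nonneg fun z => by positivity
  have hd : density N u y = ∑ j : Fin N, ∫ z : {k : Fin N // k ≠ j} → ℂ,
      ‖u (insertAt j y z)‖ ^ 2 := rfl
  obtain ⟨r, hr⟩ := exists_norm_le_of_ne_zero hu.compactSupport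
  rw [hd, ENNReal.ofReal_pow (Finset.sum_nonneg fun j _ => h0 j),
    ENNReal.ofReal_sum_of_nonneg fun j _ => h0 j]
  congr 1
  refine Finset.sum_congr rfl fun j _ => ?_
  have hc : Continuous fun z : {k : Fin N // k ≠ j} → ℂ => insertAt j y z := by
    refine continuous_pi fun k => ?_
    by_cases h : k = j
    · subst h
      simp only [insertAt_self]
      fun_prop
    · simp only [insertAt_of_ne _ _ _ h]
      fun_prop
  have hcont : Continuous fun z : {k : Fin N // k ≠ j} → ℂ => ‖u (insertAt j y z)‖ ^ 2 :=
    ((hu.smooth.continuous.comp hc).norm).pow 2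
  have hcomp : HasCompactSupport fun z : {k : Fin N // k ≠ j} → ℂ =>
      ‖u (insertAt j y z)‖ ^ 2 := by
    refine HasCompactSupport.intro (isCompact_closedBall (0 : {k : Fin N // k ≠ j} → ℂ) r)
      fun z hz => ?_
    by_contra h
    have h1 : u (insertAt j y z) ≠ 0 := fun h1 => h (by simp [h1])
    exact hz (by simpa using (norm_insertAt_ge j y z).2.trans (hr _ h1))
  rw [ofReal_integral_eq_lintegral_ofReal (hcont.integrable_of_hasCompactSupport hcomp)
    (Filter.Eventually.of_forall fun z => by positivity)]
  refine lintegral_congr fun z => ?_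
  rw [ENNReal.ofReal_pow (norm_nonneg _), ofReal_norm]

theorem lintegral_enorm_sq_eq_one (hnorm : ∫ x : Fin N → ℂ, ‖u x‖ ^ 2 = 1) :
    ∫⁻ x, ‖u x‖ₑ ^ 2 = 1 := by
  have hi : Integrable fun x => ‖u x‖ ^ 2 := by
    by_contra h
    rw [integral_undef h] at hnorm
    exact zero_ne_one hnorm
  have h := ofReal_integral_eq_lintegral_ofReal hi
    (Filter.Eventually.of_forall fun z => by positivity)
  rw [hnorm, ENNReal.ofReal_one] at h
  rw [h]
  refine lintegral_congr fun z => ?_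
  rw [ENNReal.ofReal_pow (norm_nonneg _), ofReal_norm]

theorem local_kinetic_inequality (hu : IsAnyonWF N u) (hN : 2 ≤ N)
    (hnorm : ∫⁻ x, ‖u x‖ₑ ^ 2 = 1) (hE : ∫⁻ y, energyDensity α u y ≠ ⊤)
    (a b l : ℝ) (hl : 0 < l) :
    statC α N ^ 2 * (∫⁻ y in square a b l, edensity u y ^ 2).toReal ≤
      (8 * 2592 + 30 * 2592 ^ 2) * (∫⁻ y in square a b l, energyDensity α u y).toReal
        + 2 * 2592 ^ 2 * (statC α N ^ 2 / l ^ 2) := by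
  obtain ⟨B, hB0, hB⟩ := exists_edensity_le hu
  have hc0 : 0 ≤ statC α N := statC_nonneg α N
  have hc1 : statC α N ^ 2 ≤ 1 := pow_le_one₀ hc0 (statC_le_one hN)
  have hv : ∀ a b l, volume (square a b l) ≠ ⊤ := by
    intro a b l
    rcases le_or_gt 0 l with hl | hl
    · simp [volume_square a b hl]
    · have : square a b l = ∅ := by
        rw [Set.eq_empty_iff_forall_notMem]
        rintro z ⟨⟨h1, h2⟩, -⟩
        linarith
      simp [this]
  have hMfin : ∀ a b l, ∫⁻ y in square a b l, edensity u y ≠ ⊤ := fun a b l =>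
    ((lintegral_mono (fun y => hB y)).trans_lt (by
      rw [setLIntegral_const]
      exact ENNReal.mul_lt_top (by simp) (hv a b l).lt_top)).ne
  have hRfin : ∀ a b l, ∫⁻ y in square a b l, edensity u y ^ 2 ≠ ⊤ := fun a b l =>
    ((lintegral_mono (fun y => pow_le_pow_left₀ (by simp) (hB y) 2)).trans_lt (by
      rw [setLIntegral_const]
      exact ENNReal.mul_lt_top (by simp) (hv a b l).lt_top)).ne
  have hTfin : ∀ a b l, ∫⁻ y in square a b l, energyDensity α u y ≠ ⊤ := fun a b l =>
    ((setLIntegral_le_lintegral _ _).trans_lt hE.lt_top).ne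
  have hGle : ∀ a b l s, 0 < s → ∫⁻ y in square a b l, gradBound α u y ≤
      ENNReal.ofReal s * (∫⁻ y in square a b l, edensity u y)
        + ENNReal.ofReal s⁻¹ * ∫⁻ y in square a b l, energyDensity α u y := by
    intro a b l s hs
    rw [setLIntegral_energyDensity hu.smooth (measurableSet_square a b l)]
    exact lintegral_gradBound_le hu.smooth (measurableSet_square a b l) hs
  have hGfin : ∀ a b l, ∫⁻ y in square a b l, gradBound α u y ≠ ⊤ := fun a b l =>
    ((hGle a b l 1 one_pos).trans_lt (ENNReal.add_lt_top.2
      ⟨ENNReal.mul_lt_top (by simp) (hMfin a b l).lt_top,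
        ENNReal.mul_lt_top (by simp) (hTfin a b l).lt_top⟩)).ne
  have hGMT : ∀ a b l, (∫⁻ y in square a b l, gradBound α u y).toReal ^ 2 ≤
      4 * (∫⁻ y in square a b l, edensity u y).toReal *
        (∫⁻ y in square a b l, energyDensity α u y).toReal := by
    intro a b l
    refine sq_le_four_mul_of_forall_le ENNReal.toReal_nonneg ENNReal.toReal_nonneg
      ENNReal.toReal_nonneg fun s hs => ?_
    have h1 : ENNReal.ofReal s * (∫⁻ y in square a b l, edensity u y) ≠ ⊤ :=
      ENNReal.mul_ne_top (by simp) (hMfin a b l)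
    have h2 : ENNReal.ofReal s⁻¹ * (∫⁻ y in square a b l, energyDensity α u y) ≠ ⊤ :=
      ENNReal.mul_ne_top (by simp) (hTfin a b l)
    have h3 := ENNReal.toReal_mono (ENNReal.add_ne_top.2 ⟨h1, h2⟩) (hGle a b l s hs)
    rwa [ENNReal.toReal_add h1 h2, ENNReal.toReal_mul, ENNReal.toReal_mul,
      ENNReal.toReal_ofReal hs.le, ENNReal.toReal_ofReal (inv_nonneg.2 hs.le)] at h3
  refine dyadic_bound (M := fun a b l => (∫⁻ y in square a b l, edensity u y).toReal)
    (T := fun a b l => (∫⁻ y in square a b l, energyDensity α u y).toReal)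
    (R := fun a b l => (∫⁻ y in square a b l, edensity u y ^ 2).toReal) (B := B)
    (sq_nonneg _) (fun _ _ _ => ENNReal.toReal_nonneg) ?_
    (fun a b l hl => toReal_setLIntegral_square_split hMfin a b hl)
    (fun a b l hl => toReal_setLIntegral_square_split hTfin a b hl)
    (fun a b l hl => toReal_setLIntegral_square_split hRfin a b hl) ?_ ?_ a b l hl
  · intro a b l hl
    have h1 : ∫⁻ y in square a b l, edensity u y ≤ ENNReal.ofReal (B * l ^ 2) := by
      refine (lintegral_mono fun y => hB y).trans (le_of_eq ?_)
      rw [setLIntegral_const, volume_square a b hl.le, ENNReal.ofReal_mul hB0]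
    exact ENNReal.toReal_le_of_le_ofReal (by positivity) h1
  · intro a b l hl hM
    refine mul_sq_le_of_uncertainty (sq_nonneg _) hc1 ENNReal.toReal_nonneg
      ENNReal.toReal_nonneg hl (hGMT a b l) ?_ hM
    have h1 : ENNReal.ofReal l * (∫⁻ y in square a b l, gradBound α u y) ≠ ⊤ :=
      ENNReal.mul_ne_top (by simp) (hGfin a b l)
    have h0 : ENNReal.ofReal l ^ 2 * ∫⁻ y in square a b l, edensity u y ^ 2 ≤
        ((∫⁻ y in square a b l, edensity u y)
          + ENNReal.ofReal l * ∫⁻ y in square a b l, gradBound α u y) ^ 2 :=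
      lintegral_edensity_sq_le hu.smooth a b l
    have h2 := ENNReal.toReal_mono
      (ENNReal.pow_ne_top (ENNReal.add_ne_top.2 ⟨hMfin a b l, h1⟩)) h0
    rwa [ENNReal.toReal_mul, ENNReal.toReal_pow, ENNReal.toReal_pow,
      ENNReal.toReal_add (hMfin a b l) h1, ENNReal.toReal_mul,
      ENNReal.toReal_ofReal hl.le] at h2
  · intro a b l hl hM
    have h1 : ENNReal.ofReal l * (∫⁻ y in square a b l, gradBound α u y) ≠ ⊤ :=
      ENNReal.mul_ne_top (by simp) (hGfin a b l)
    have hK := hMfin (a + l / 3) (b + l / 3) (l / 3)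
    have hQ := hMfin a b l
    have hT := hTfin a b l
    refine energy_lower_bound_of_heavy (sq_nonneg _) hc1
      (K := (∫⁻ y in square (a + l / 3) (b + l / 3) (l / 3), edensity u y).toReal)
      hl (hGMT a b l) ?_ ?_ hM
    · have h9 : 9 * (∫⁻ y in square (a + l / 3) (b + l / 3) (l / 3), edensity u y) ≠ ⊤ :=
        ENNReal.mul_ne_top (by simp) hK
      have h4 : 4 * (ENNReal.ofReal l * ∫⁻ y in square a b l, gradBound α u y) ≠ ⊤ :=
        ENNReal.mul_ne_top (by simp) h1
      have h2 := ENNReal.toReal_mono (ENNReal.add_ne_top.2 ⟨h9, h4⟩)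
        (mass_le_middle (α := α) hu.smooth a b hl)
      rw [ENNReal.toReal_add h9 h4, ENNReal.toReal_mul, ENNReal.toReal_mul, ENNReal.toReal_mul,
        ENNReal.toReal_ofReal hl.le] at h2
      simpa using h2
    · have h3 := exclusion_inequality (α := α) hu hnorm a b l
      rw [← setLIntegral_energyDensity hu.smooth (measurableSet_square a b l)] at h3
      have h4 : ENNReal.ofReal (statC α N) ^ 2 *
          ((∫⁻ y in square a b l, edensity u y) + 324) ≠ ⊤ :=
        ENNReal.mul_ne_top (by simp) (by simp [hQ])
      have h5 : 972 * (ENNReal.ofReal l ^ 2 * ∫⁻ y in square a b l, energyDensity α u y) ≠ ⊤ :=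
        ENNReal.mul_ne_top (by simp) (ENNReal.mul_ne_top (by simp) hT)
      have h6 := ENNReal.toReal_mono (ENNReal.add_ne_top.2 ⟨h4, h5⟩) h3
      rw [ENNReal.toReal_add h4 h5] at h6
      simp only [ENNReal.toReal_mul, ENNReal.toReal_pow, ENNReal.toReal_ofReal hc0,
        ENNReal.toReal_ofReal hl.le, ENNReal.toReal_add hQ (by simp : (324 : ℝ≥0∞) ≠ ⊤),
        ENNReal.toReal_ofNat] at h6
      exact h6

theorem edensity_sq_le_energy (hu : IsAnyonWF N u) (hN : 2 ≤ N)
    (hnorm : ∫⁻ x, ‖u x‖ₑ ^ 2 = 1) :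
    ENNReal.ofReal ((8 * 2592 + 30 * 2592 ^ 2)⁻¹ * statC α N ^ 2) * ∫⁻ y, edensity u y ^ 2 ≤
      ∫⁻ y, energyDensity α u y := by
  by_cases hE : ∫⁻ y, energyDensity α u y = ⊤
  · rw [hE]; exact le_top
  obtain ⟨r, hr⟩ := exists_edensity_eq_zero hu.compactSupport
  obtain ⟨B, hB0, hB⟩ := exists_edensity_le hu
  have hwhole : ∀ L : ℝ, r < L → ∫⁻ y in square (-L) (-L) (2 * L), edensity u y ^ 2
      = ∫⁻ y, edensity u y ^ 2 := by
    intro L hL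
    refine setLIntegral_eq_of_support_subset ?_
    intro y hy
    have hy' : ‖y‖ ≤ r := by
      by_contra h
      exact hy (by simp [hr y (not_le.1 h)])
    have h1 := abs_le.1 ((Complex.abs_re_le_norm y).trans hy')
    have h2 := abs_le.1 ((Complex.abs_im_le_norm y).trans hy')
    exact ⟨⟨by linarith, by linarith⟩, by linarith, by linarith⟩
  have hbound : ∀ L : ℝ, 0 < L → r < L →
      statC α N ^ 2 * (∫⁻ y, edensity u y ^ 2).toReal ≤
        (8 * 2592 + 30 * 2592 ^ 2) * (∫⁻ y, energyDensity α u y).toReal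
          + 2 * 2592 ^ 2 * (statC α N ^ 2 / (2 * L) ^ 2) := by
    intro L hL hrL
    have h1 := local_kinetic_inequality (α := α) hu hN hnorm hE (-L) (-L) (2 * L) (by linarith)
    rw [hwhole L hrL] at h1
    refine h1.trans ?_
    gcongr
    exact Measure.restrict_le_self
  have hlim : statC α N ^ 2 * (∫⁻ y, edensity u y ^ 2).toReal ≤
        (8 * 2592 + 30 * 2592 ^ 2) * (∫⁻ y, energyDensity α u y).toReal := by
    have ht : Filter.Tendsto (fun L : ℝ =>
        (8 * 2592 + 30 * 2592 ^ 2) * (∫⁻ y, energyDensity α u y).toReal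
          + 2 * 2592 ^ 2 * (statC α N ^ 2 / (2 * L) ^ 2)) Filter.atTop
        (nhds ((8 * 2592 + 30 * 2592 ^ 2) * (∫⁻ y, energyDensity α u y).toReal
          + 2 * 2592 ^ 2 * 0)) := by
      refine (Filter.Tendsto.const_mul _ ?_).const_add _
      refine Filter.Tendsto.div_atTop tendsto_const_nhds ?_
      exact (Filter.tendsto_pow_atTop two_ne_zero).comp
        (Filter.tendsto_id.const_mul_atTop two_pos)
    rw [mul_zero, add_zero] at ht
    refine ge_of_tendsto ht ?_
    filter_upwards [Filter.eventually_gt_atTop 0, Filter.eventually_gt_atTop r] with L h1 h2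
    exact hbound L h1 h2
  have hRfin : ∫⁻ y, edensity u y ^ 2 ≠ ⊤ := by
    have hL : r < |r| + 1 := by linarith [le_abs_self r]
    rw [← hwhole _ hL]
    refine ((lintegral_mono (fun y => pow_le_pow_left₀ (by simp) (hB y) 2)).trans_lt ?_).ne
    rw [setLIntegral_const, volume_square _ _ (by positivity)]
    exact ENNReal.mul_lt_top (by simp) (by simp)
  rw [← ENNReal.ofReal_toReal hRfin, ← ENNReal.ofReal_mul (by positivity),
    ← ENNReal.ofReal_toReal hE]
  apply ENNReal.ofReal_le_ofReal
  rw [mul_assoc, inv_mul_le_iff₀ (by norm_num)]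
  exact hlim

theorem lintegral_energyDensity (hu : ContDiff ℝ (⊤ : ℕ∞) u) :
    ∫⁻ y, energyDensity α u y = ∑ j, ∫⁻ x, ENNReal.ofReal (covSq α u j x) := by
  rw [← setLIntegral_univ, setLIntegral_energyDensity hu MeasurableSet.univ]
  simp [localEnergy, covNorm_sq]

end Density

end AnyonKineticEnergy

/-- **Theorem (kinetic energy inequality for anyons).** There is a universal `C_K > 0`
such that for every `α ∈ ℝ`, every `N ≥ 2` and every normalized `N`-anyon wave function
`u` with one-particle density `ρ`,
`∑_j ∫ |D_j u|² ≥ C_K · C_{α,N}² · ∫_{ℝ²} ρ²`. -/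
theorem kinetic_energy_inequality :
    ∃ C : ℝ, 0 < C ∧ ∀ (α : ℝ) (N : ℕ), 2 ≤ N →
      ∀ u : (Fin N → ℂ) → ℂ, IsAnyonWF N u → (∫ x : Fin N → ℂ, ‖u x‖ ^ 2) = 1 →
      ENNReal.ofReal (C * statC α N ^ 2) *
          ∫⁻ y : ℂ, ENNReal.ofReal (density N u y ^ 2) ≤
        ∑ j : Fin N, ∫⁻ x : Fin N → ℂ, ENNReal.ofReal (covSq α u j x) := by
  refine ⟨(8 * 2592 + 30 * 2592 ^ 2)⁻¹, by norm_num, fun α N hN u hu hnorm => ?_⟩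
  simp_rw [ofReal_density_sq hu]
  rw [← lintegral_energyDensity hu.smooth]
  exact edensity_sq_le_energy hu hN (lintegral_enorm_sq_eq_one hnorm)

end
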